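/- Let (X,d,μ) be a space of homogeneous type with μ(X) = ∞ and μ({x₀}) = 0 for all x₀ ∈ X, let γ, κ ∈ (0,1), 1 < p < 1/γ, 1/q = 1/p − γ, ω ∈ A_{p,q}(X), and let b be a locally integrable function. If the commutator [M_γ, b] is bounded from L^{p,κ}_{(ω^p,ω^q)}(X) to L^{q,κq/p}_{ω^q}(X), then there is a constant C with sup_Q ‖(b − μ(Q)^{-γ} M_{γ,Q}(b))χ_Q‖_{L^{q,κq/p}_{ω^q}(X)} / ‖χ_Q‖_{L^{q,κq/p}_{ω^q}(X)} ≤ C, the supremum over all balls Q ⊂ X. -/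

import Mathlib

open MeasureTheory ENNReal

noncomputable section

namespace SHT

variable {X : Type*} [MeasurableSpace X]

/-- The quasi-metric ball `B(x, r) = {y : d x y < r}`. -/
def ball (d : X → X → ℝ) (x : X) (r : ℝ) : Set X := {y | d x y < r}

/-- `(X, d, μ)` is a space of homogeneous type: `d` is a quasi-metric and `μ` is a
nonzero (Borel) measure, finite and doubling on balls. -/
structure IsSHT (d : X → X → ℝ) (μ : Measure X) : Prop where
  nonneg : ∀ x y, 0 ≤ d x y
  symm : ∀ x y, d x y = d y x
  eq_zero_iff : ∀ x y, d x y = 0 ↔ x = y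
  quasi_triangle : ∃ A₀ : ℝ, 1 ≤ A₀ ∧ ∀ x y z, d x y ≤ A₀ * (d x z + d z y)
  measurableSet_ball : ∀ (x : X) (r : ℝ), MeasurableSet (ball d x r)
  ne_zero : μ ≠ 0
  doubling : ∃ C : ℝ≥0∞, C ≠ ⊤ ∧ ∀ (x : X) (r : ℝ), 0 < r →
    μ (ball d x (2 * r)) ≤ C * μ (ball d x r)
  ball_lt_top : ∀ (x : X) (r : ℝ), 0 < r → μ (ball d x r) < ⊤

/-- Locally integrable: measurable and integrable on every ball. -/
def LocInt (d : X → X → ℝ) (μ : Measure X) (f : X → ℝ) : Prop :=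
  Measurable f ∧ ∀ (x : X) (r : ℝ), 0 < r → IntegrableOn f (ball d x r) μ

/-- The average `f_B = μ(B)⁻¹ ∫_B f dμ`. -/
def avg (μ : Measure X) (B : Set X) (f : X → ℝ) : ℝ :=
  (μ B).toReal⁻¹ * ∫ y in B, f y ∂μ

/-- The weighted measure `ω(B) = ∫_B ω dμ`. -/
def wMeas (μ : Measure X) (ω : X → ℝ) (B : Set X) : ℝ≥0∞ :=
  ∫⁻ y in B, ENNReal.ofReal (ω y) ∂μ

/-- The BMO seminorm `sup_B μ(B)⁻¹ ∫_B |b - b_B| dμ`. -/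
def bmoNorm (d : X → X → ℝ) (μ : Measure X) (b : X → ℝ) : ℝ≥0∞ :=
  ⨆ (x : X) (r : ℝ) (_ : 0 < r),
    (μ (ball d x r))⁻¹ *
      ∫⁻ y in ball d x r, ENNReal.ofReal (|b y - avg μ (ball d x r) b|) ∂μ

/-- `b ∈ BMO(X)`. -/
def MemBMO (d : X → X → ℝ) (μ : Measure X) (b : X → ℝ) : Prop := bmoNorm d μ b < ⊤

/-- `b⁻ = max (-b) 0 ∈ L^∞(X)`. -/
def NegBdd (μ : Measure X) (b : X → ℝ) : Prop :=
  ∃ K : ℝ, ∀ᵐ x ∂μ, max (-b x) 0 ≤ K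

/-- Two-weight Morrey norm `sup_B (v(B)^{-κ} ∫_B |f|^p u dμ)^{1/p}`. -/
def morrey2 (d : X → X → ℝ) (μ : Measure X) (u v : X → ℝ) (p κ : ℝ) (f : X → ℝ) : ℝ≥0∞ :=
  ⨆ (x : X) (r : ℝ) (_ : 0 < r),
    ((wMeas μ v (ball d x r) ^ κ)⁻¹ *
      ∫⁻ y in ball d x r, ENNReal.ofReal (|f y| ^ p * u y) ∂μ) ^ (1 / p)

/-- One-weight Morrey norm `sup_B (ω(B)^{-κ} ∫_B |f|^p ω dμ)^{1/p}`. -/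
def morrey (d : X → X → ℝ) (μ : Measure X) (ω : X → ℝ) (p κ : ℝ) (f : X → ℝ) : ℝ≥0∞ :=
  morrey2 d μ ω ω p κ f

/-- `M_p f(x) = sup_{B ∋ x} (μ(B)⁻¹ ∫_B |f|^p dμ)^{1/p}`, with values in `ℝ≥0∞`. -/
def maxFunE (d : X → X → ℝ) (μ : Measure X) (p : ℝ) (f : X → ℝ) (x : X) : ℝ≥0∞ :=
  ⨆ (z : X) (r : ℝ) (_ : 0 < r) (_ : x ∈ ball d z r),
    ((μ (ball d z r))⁻¹ * ∫⁻ y in ball d z r, ENNReal.ofReal (|f y| ^ p) ∂μ) ^ (1 / p)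

/-- The Hardy–Littlewood-type maximal function `M_p f`. -/
def maxFun (d : X → X → ℝ) (μ : Measure X) (p : ℝ) (f : X → ℝ) (x : X) : ℝ :=
  (maxFunE d μ p f x).toReal

/-- The local maximal function `M_{p,B₀} f(x)`, supremum over balls `B` with
`x ∈ B ⊆ B₀`. -/
def maxFunLoc (d : X → X → ℝ) (μ : Measure X) (p : ℝ) (B₀ : Set X) (f : X → ℝ) (x : X) : ℝ :=
  (⨆ (z : X) (r : ℝ) (_ : 0 < r) (_ : x ∈ ball d z r) (_ : ball d z r ⊆ B₀),
    ((μ (ball d z r))⁻¹ *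
      ∫⁻ y in ball d z r, ENNReal.ofReal (|f y| ^ p) ∂μ) ^ (1 / p)).toReal

/-- The commutator `[M_p, b] f (x) = b(x) M_p f(x) - M_p (b f)(x)`. -/
def commMax (d : X → X → ℝ) (μ : Measure X) (p : ℝ) (b f : X → ℝ) (x : X) : ℝ :=
  b x * maxFun d μ p f x - maxFun d μ p (fun y => b y * f y) x

/-- The Fefferman–Stein sharp maximal function `M^♯ f`. -/
def sharp (d : X → X → ℝ) (μ : Measure X) (f : X → ℝ) (x : X) : ℝ :=
  (⨆ (z : X) (r : ℝ) (_ : 0 < r) (_ : x ∈ ball d z r),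
    (μ (ball d z r))⁻¹ *
      ∫⁻ y in ball d z r, ENNReal.ofReal (|f y - avg μ (ball d z r) f|) ∂μ).toReal

/-- The commutator `[M^♯, b] f (x) = b(x) M^♯ f(x) - M^♯ (b f)(x)`. -/
def commSharp (d : X → X → ℝ) (μ : Measure X) (b f : X → ℝ) (x : X) : ℝ :=
  b x * sharp d μ f x - sharp d μ (fun y => b y * f y) x

/-- The fractional maximal function `M_γ f(x) = sup_{B ∋ x} μ(B)^{γ-1} ∫_B |f| dμ`. -/
def fracMax (d : X → X → ℝ) (μ : Measure X) (γ : ℝ) (f : X → ℝ) (x : X) : ℝ :=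
  (⨆ (z : X) (r : ℝ) (_ : 0 < r) (_ : x ∈ ball d z r),
    μ (ball d z r) ^ (γ - 1) * ∫⁻ y in ball d z r, ENNReal.ofReal (|f y|) ∂μ).toReal

/-- The local fractional maximal function `M_{γ,B₀} f`. -/
def fracMaxLoc (d : X → X → ℝ) (μ : Measure X) (γ : ℝ) (B₀ : Set X) (f : X → ℝ) (x : X) : ℝ :=
  (⨆ (z : X) (r : ℝ) (_ : 0 < r) (_ : x ∈ ball d z r) (_ : ball d z r ⊆ B₀),
    μ (ball d z r) ^ (γ - 1) * ∫⁻ y in ball d z r, ENNReal.ofReal (|f y|) ∂μ).toReal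

/-- The commutator `[M_γ, b] f (x) = b(x) M_γ f(x) - M_γ (b f)(x)`. -/
def commFrac (d : X → X → ℝ) (μ : Measure X) (γ : ℝ) (b f : X → ℝ) (x : X) : ℝ :=
  b x * fracMax d μ γ f x - fracMax d μ γ (fun y => b y * f y) x

/-- The maximal commutator `C_b f(x) = sup_{B ∋ x} μ(B)⁻¹ ∫_B |b(x)-b(y)||f(y)| dμ(y)`. -/
def maxComm (d : X → X → ℝ) (μ : Measure X) (b f : X → ℝ) (x : X) : ℝ :=
  (⨆ (z : X) (r : ℝ) (_ : 0 < r) (_ : x ∈ ball d z r),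
    (μ (ball d z r))⁻¹ *
      ∫⁻ y in ball d z r, ENNReal.ofReal (|b x - b y| * |f y|) ∂μ).toReal

/-- The fractional maximal commutator
`M_{γ,b} f(x) = sup_{B ∋ x} μ(B)^{γ-1} ∫_B |b(x)-b(y)||f(y)| dμ(y)`. -/
def fracMaxComm (d : X → X → ℝ) (μ : Measure X) (γ : ℝ) (b f : X → ℝ) (x : X) : ℝ :=
  (⨆ (z : X) (r : ℝ) (_ : 0 < r) (_ : x ∈ ball d z r),
    μ (ball d z r) ^ (γ - 1) *
      ∫⁻ y in ball d z r, ENNReal.ofReal (|b x - b y| * |f y|) ∂μ).toReal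

/-- The Muckenhoupt `A_p` constant, for `1 < p < ∞`, where `p' = p/(p-1)`. -/
def apConst (d : X → X → ℝ) (μ : Measure X) (ω : X → ℝ) (p : ℝ) : ℝ≥0∞ :=
  ⨆ (x : X) (r : ℝ) (_ : 0 < r),
    ((μ (ball d x r))⁻¹ * ∫⁻ y in ball d x r, ENNReal.ofReal (ω y) ∂μ) *
      ((μ (ball d x r))⁻¹ *
        ∫⁻ y in ball d x r, ENNReal.ofReal (ω y ^ (1 - p / (p - 1))) ∂μ) ^ (p - 1)

/-- `ω ∈ A_p(X)` for `1 < p < ∞`. -/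
def MemAp (d : X → X → ℝ) (μ : Measure X) (ω : X → ℝ) (p : ℝ) : Prop :=
  apConst d μ ω p < ⊤

/-- `ω ∈ A_1(X)`: `Mω ≤ ω` a.e. -/
def MemA1 (d : X → X → ℝ) (μ : Measure X) (ω : X → ℝ) : Prop :=
  ∀ᵐ x ∂μ, maxFunE d μ 1 ω x ≤ ENNReal.ofReal (ω x)

/-- The `A_{p,q}` constant, `1 < p < q < ∞`, where `p' = p/(p-1)`. -/
def apqConst (d : X → X → ℝ) (μ : Measure X) (ω : X → ℝ) (p q : ℝ) : ℝ≥0∞ :=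
  ⨆ (x : X) (r : ℝ) (_ : 0 < r),
    ((μ (ball d x r))⁻¹ * ∫⁻ y in ball d x r, ENNReal.ofReal (ω y ^ q) ∂μ) ^ (1 / q) *
      ((μ (ball d x r))⁻¹ *
        ∫⁻ y in ball d x r, ENNReal.ofReal (ω y ^ (-(p / (p - 1)))) ∂μ) ^ (1 - 1 / p)

/-- `ω ∈ A_{p,q}(X)`. -/
def MemApq (d : X → X → ℝ) (μ : Measure X) (ω : X → ℝ) (p q : ℝ) : Prop :=
  apqConst d μ ω p q < ⊤

/-- A weight: a nonnegative locally integrable function. -/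
def IsWeight (d : X → X → ℝ) (μ : Measure X) (ω : X → ℝ) : Prop :=
  (∀ x, 0 ≤ ω x) ∧ LocInt d μ ω

end SHT

open SHT

theorem aux_union {X : Type*} [MeasurableSpace X] {d : X → X → ℝ} (x : X) {r : ℝ} (hr : 0 < r) :
    (⋃ n : ℕ, ball d x (2 ^ n * r)) = Set.univ := by
  ext y
  simp only [Set.mem_iUnion, Set.mem_univ, iff_true, ball, Set.mem_ofPred_eq]
  obtain ⟨n, hn⟩ := pow_unbounded_of_one_lt (d x y / r) (one_lt_two)
  exact ⟨n, by rwa [div_lt_iff₀ hr] at hn⟩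

theorem aux_ball_pos {X : Type*} [MeasurableSpace X] {d : X → X → ℝ} {μ : Measure X}
    (hX : IsSHT d μ) (x : X) {r : ℝ} (hr : 0 < r) : 0 < μ (ball d x r) := by
  rw [pos_iff_ne_zero]
  intro h0
  obtain ⟨C, -, hC⟩ := hX.doubling
  have h : ∀ n : ℕ, μ (ball d x (2 ^ n * r)) = 0 := by
    intro n
    induction n with
    | zero => simpa using h0
    | succ k ih =>
      have := hC x (2 ^ k * r) (by positivity)
      rw [ih, mul_zero, ← mul_assoc, ← pow_succ'] at this
      exact le_antisymm this bot_le
  apply hX.ne_zero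
  rw [← Measure.measure_univ_eq_zero, ← aux_union (d := d) x hr]
  exact measure_iUnion_null h

theorem aux_real_pos {X : Type*} [MeasurableSpace X] {d : X → X → ℝ} {μ : Measure X}
    (hX : IsSHT d μ) (x : X) {r : ℝ} (hr : 0 < r) : 0 < μ.real (ball d x r) :=
  ENNReal.toReal_pos (aux_ball_pos hX x hr).ne' (hX.ball_lt_top x r hr).ne

theorem aux_ball_mono {X : Type*} [MeasurableSpace X] {d : X → X → ℝ} (x : X) {r s : ℝ}
    (h : r ≤ s) : ball d x r ⊆ ball d x s := fun _ hy => lt_of_lt_of_le hy h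

theorem aux_real_mono {X : Type*} [MeasurableSpace X] {d : X → X → ℝ} {μ : Measure X}
    (hX : IsSHT d μ) {S : Set X} (x : X) {r : ℝ} (hr : 0 < r) (h : S ⊆ ball d x r) :
    μ.real S ≤ μ.real (ball d x r) :=
  measureReal_mono h (hX.ball_lt_top x r hr).ne

theorem aux_dbl {X : Type*} [MeasurableSpace X] {d : X → X → ℝ} {μ : Measure X}
    (hX : IsSHT d μ) : ∃ C : ℝ, 1 ≤ C ∧ ∀ (x : X) (r : ℝ), 0 < r →
      μ.real (ball d x (2 * r)) ≤ C * μ.real (ball d x r) := by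
  obtain ⟨C, hCt, hC⟩ := hX.doubling
  refine ⟨max 1 C.toReal, le_max_left _ _, fun x r hr => ?_⟩
  have h := ENNReal.toReal_mono (ENNReal.mul_ne_top hCt (hX.ball_lt_top x r hr).ne) (hC x r hr)
  rw [ENNReal.toReal_mul] at h
  exact h.trans (mul_le_mul_of_nonneg_right (le_max_right _ _) ENNReal.toReal_nonneg)

theorem aux_dblL {X : Type*} [MeasurableSpace X] {d : X → X → ℝ} {μ : Measure X}
    (hX : IsSHT d μ) (L : ℝ) : ∃ C : ℝ, 1 ≤ C ∧ ∀ (x : X) (r : ℝ), 0 < r →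
      μ.real (ball d x (L * r)) ≤ C * μ.real (ball d x r) := by
  obtain ⟨C, hC1, hC⟩ := aux_dbl hX
  obtain ⟨n, hn⟩ := pow_unbounded_of_one_lt L (one_lt_two)
  refine ⟨C ^ n, one_le_pow₀ hC1, fun x r hr => ?_⟩
  have h : ∀ k : ℕ, μ.real (ball d x (2 ^ k * r)) ≤ C ^ k * μ.real (ball d x r) := by
    intro k
    induction k with
    | zero => simp
    | succ k ih =>
      have := hC x (2 ^ k * r) (by positivity)
      rw [← mul_assoc, ← pow_succ'] at this
      refine this.trans ?_
      rw [pow_succ', mul_assoc]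
      exact mul_le_mul_of_nonneg_left ih (by linarith)
  refine le_trans (aux_real_mono hX x (by positivity) (aux_ball_mono x ?_)) (h n)
  exact mul_le_mul_of_nonneg_right hn.le hr.le

theorem aux_ball_sub {X : Type*} [MeasurableSpace X] {d : X → X → ℝ} {μ : Measure X}
    (hX : IsSHT d μ) : ∃ L : ℝ, 1 ≤ L ∧ ∀ (x z w : X) (r s : ℝ), 0 < r → r ≤ s →
      w ∈ ball d x r → w ∈ ball d z s → ball d x r ⊆ ball d z (L * s) := by
  obtain ⟨A, hA1, hA⟩ := hX.quasi_triangle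
  refine ⟨3 * A ^ 2, by nlinarith, fun x z w r s hr hrs hw1 hw2 y hy => ?_⟩
  simp only [ball, Set.mem_ofPred_eq] at *
  have h1 := hA z y w
  have h2 := hA w y x
  rw [hX.symm w x] at h2
  have h3 : d w y < A * (2 * s) := by
    refine h2.trans_lt (mul_lt_mul_of_pos_left (by linarith) (by linarith))
  have h4 : d z w + d w y < s + A * (2 * s) := by linarith
  have h5 : A * (d z w + d w y) < A * (s + A * (2 * s)) :=
    mul_lt_mul_of_pos_left h4 (by linarith)
  have h6 : A * s ≤ A * A * s := by
    have : A * s * 1 ≤ A * s * A := mul_le_mul_of_nonneg_left hA1 (by nlinarith)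
    nlinarith
  nlinarith

theorem aux_cmp {X : Type*} [MeasurableSpace X] {d : X → X → ℝ} {μ : Measure X}
    (hX : IsSHT d μ) {g : X → ℝ} (hg : LocInt d μ g) {A : ℝ}
    (hA : ∀ (x : X) (r : ℝ), 0 < r →
      ∫ y in ball d x r, |g y - avg μ (ball d x r) g| ∂μ ≤ A * μ.real (ball d x r))
    (z x : X) {s r : ℝ} (hs : 0 < s) (hr : 0 < r) (hsub : ball d z s ⊆ ball d x r) :
    |avg μ (ball d z s) g - avg μ (ball d x r) g| ≤
      A * (μ.real (ball d x r) / μ.real (ball d z s)) := by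
  set c := avg μ (ball d x r) g with hc
  have hpos := aux_real_pos hX z hs
  have hfs : IsFiniteMeasure (μ.restrict (ball d z s)) :=
    ⟨by simpa using hX.ball_lt_top z s hs⟩
  have hfr : IsFiniteMeasure (μ.restrict (ball d x r)) :=
    ⟨by simpa using hX.ball_lt_top x r hr⟩
  have h1 : avg μ (ball d z s) g - c =
      (μ.real (ball d z s))⁻¹ * ∫ y in ball d z s, (g y - c) ∂μ := by
    rw [integral_sub (hg.2 z s hs) (integrable_const c)]
    simp only [avg, integral_const, smul_eq_mul]
    rw [measureReal_restrict_apply_univ]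
    simp only [Measure.real] at hpos ⊢
    field_simp
  rw [h1, abs_mul, abs_of_pos (inv_pos.2 hpos)]
  have h2 : |∫ y in ball d z s, (g y - c) ∂μ| ≤ ∫ y in ball d z s, |g y - c| ∂μ :=
    abs_integral_le_integral_abs
  have h3 : ∫ y in ball d z s, |g y - c| ∂μ ≤ ∫ y in ball d x r, |g y - c| ∂μ := by
    apply setIntegral_mono_set
    · exact ((hg.2 x r hr).sub (integrable_const c)).abs
    · exact Filter.Eventually.of_forall fun y => abs_nonneg _
    · exact hsub.eventuallyLE
  have h4 := (h2.trans h3).trans (hA x r hr)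
  calc _ ≤ (μ.real (ball d z s))⁻¹ * (A * μ.real (ball d x r)) :=
        mul_le_mul_of_nonneg_left h4 (inv_pos.2 hpos).le
    _ = _ := by field_simp

theorem aux_grow {X : Type*} [MeasurableSpace X] {d : X → X → ℝ} {μ : Measure X}
    (hX : IsSHT d μ) (hμtop : μ Set.univ = ⊤) {C : ℝ} (hC1 : 1 ≤ C)
    (hC : ∀ (x : X) (r : ℝ), 0 < r → μ.real (ball d x (2 * r)) ≤ C * μ.real (ball d x r))
    (z : X) {s : ℝ} (hs : 0 < s) : ∃ s', s ≤ s' ∧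
      2 * μ.real (ball d z s) ≤ μ.real (ball d z s') ∧
      μ.real (ball d z s') ≤ 2 * C * μ.real (ball d z s) := by
  have hpos := aux_real_pos hX z hs
  have hex : ∃ n : ℕ, 2 * μ.real (ball d z s) ≤ μ.real (ball d z (2 ^ n * s)) := by
    by_contra! hcon
    have h1 : μ (⋃ n : ℕ, ball d z (2 ^ n * s)) ≤ ENNReal.ofReal (2 * μ.real (ball d z s)) := by
      rw [Monotone.measure_iUnion]
      · refine iSup_le fun n => ?_
        rw [ENNReal.le_ofReal_iff_toReal_le (hX.ball_lt_top _ _ (by positivity)).ne (by positivity)]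
        exact (hcon n).le
      · intro a b hab
        exact aux_ball_mono z (mul_le_mul_of_nonneg_right
          (pow_le_pow_right₀ one_le_two hab) hs.le)
    rw [aux_union z hs, hμtop] at h1
    exact lt_irrefl _ (h1.trans_lt ENNReal.ofReal_lt_top)
  classical
  have hspec := Nat.find_spec hex
  have hmin := fun m => @Nat.find_min _ _ hex m
  set n := Nat.find hex
  cases hn : n with
  | zero => rw [hn] at hspec; simp at hspec; linarith
  | succ k =>
    rw [hn] at hspec
    have hk := hmin k (by omega)
    push Not at hk
    refine ⟨2 ^ (k + 1) * s, ?_, hspec, ?_⟩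
    · exact le_mul_of_one_le_left hs.le (one_le_pow₀ one_le_two)
    · have := hC z (2 ^ k * s) (by positivity)
      rw [← mul_assoc, ← pow_succ'] at this
      refine this.trans ?_
      nlinarith

theorem aux_key {X : Type*} [MeasurableSpace X] {d : X → X → ℝ} {μ : Measure X}
    (hX : IsSHT d μ) (hμtop : μ Set.univ = ⊤) {γ : ℝ} (hγ : 0 < γ)
    {g : X → ℝ} (hg : LocInt d μ g) {A : ℝ} (hA0 : 0 ≤ A)
    (hA : ∀ (x : X) (r : ℝ), 0 < r →
      ∫ y in ball d x r, |g y - avg μ (ball d x r) g| ∂μ ≤ A * μ.real (ball d x r)) :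
    ∃ D : ℝ, 0 ≤ D ∧ ∀ (x z w : X) (r s : ℝ), 0 < r → 0 < s → w ∈ ball d x r → w ∈ ball d z s →
      μ.real (ball d z s) ≤ μ.real (ball d x r) →
      μ.real (ball d z s) ^ γ * (avg μ (ball d z s) g - avg μ (ball d x r) g) ≤
        D * μ.real (ball d x r) ^ γ := by
  obtain ⟨C, hC1, hC⟩ := aux_dbl hX
  obtain ⟨L, hL1, hL⟩ := aux_ball_sub hX
  obtain ⟨E, hE1, hE⟩ := aux_dblL hX L
  set t : ℝ := 2 ^ (-γ) with ht
  have ht0 : 0 < t := by positivity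
  have ht1 : t < 1 := Real.rpow_lt_one_of_one_lt_of_neg one_lt_two (by linarith)
  set D1 : ℝ := A * (E * (2 * C)) + A * (E * (2 * C)) with hD1
  have hD10 : 0 ≤ D1 := by positivity
  set D : ℝ := (2 * C) ^ γ * D1 + 2 * C * A / (1 - t) with hD
  have h1t : 0 < 1 - t := by linarith
  have hD0 : 0 ≤ D := by positivity
  have hDa : (2 * C) ^ γ * D1 ≤ D := by
    have : 0 ≤ 2 * C * A / (1 - t) := by positivity
    linarith
  have hDb : t * D + 2 * C * A ≤ D := by
    have h : 2 * C * A / (1 - t) ≤ D := by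
      have : 0 ≤ (2 * C) ^ γ * D1 := by positivity
      linarith
    rw [div_le_iff₀ h1t] at h
    nlinarith
  refine ⟨D, hD0, ?_⟩
  have claim : ∀ (x : X) (r : ℝ), 0 < r → ∀ n : ℕ, ∀ (z w : X) (s : ℝ), 0 < s →
      w ∈ ball d x r → w ∈ ball d z s →
      μ.real (ball d x r) ≤ 2 ^ n * μ.real (ball d z s) →
      μ.real (ball d z s) ≤ 2 * C * μ.real (ball d x r) →
      μ.real (ball d z s) ^ γ * (avg μ (ball d z s) g - avg μ (ball d x r) g) ≤
        D * μ.real (ball d x r) ^ γ := by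
    intro x r hr n
    have hQ := aux_real_pos hX x hr
    induction n with
    | zero =>
      intro z w s hs hwx hwz h1 h2
      have hB := aux_real_pos hX z hs
      rw [pow_zero, one_mul] at h1
      have hav : avg μ (ball d z s) g - avg μ (ball d x r) g ≤ D1 := by
        rcases le_total r s with hrs | hrs
        · have hLs : 0 < L * s := by positivity
          have a1 := aux_cmp hX hg hA z z hs hLs
            (aux_ball_mono z (le_mul_of_one_le_left hs.le hL1))
          have a2 := aux_cmp hX hg hA x z hr hLs (hL x z w r s hr hrs hwx hwz)
          have b1 : μ.real (ball d z (L * s)) / μ.real (ball d z s) ≤ E * (2 * C) := by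
            rw [div_le_iff₀ hB]
            refine (hE z s hs).trans ?_
            have : 0 ≤ E * μ.real (ball d z s) := by positivity
            nlinarith
          have b2 : μ.real (ball d z (L * s)) / μ.real (ball d x r) ≤ E * (2 * C) := by
            rw [div_le_iff₀ hQ]
            refine (hE z s hs).trans ?_
            rw [mul_assoc]
            exact mul_le_mul_of_nonneg_left h2 (by linarith)
          have c1 := (le_abs_self _).trans (a1.trans (mul_le_mul_of_nonneg_left b1 hA0))
          have c2 := (neg_le_abs _).trans (a2.trans (mul_le_mul_of_nonneg_left b2 hA0))
          linarith
        · have hLr : 0 < L * r := by positivity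
          have a1 := aux_cmp hX hg hA z x hs hLr (hL z x w s r hs hrs hwz hwx)
          have a2 := aux_cmp hX hg hA x x hr hLr
            (aux_ball_mono x (le_mul_of_one_le_left hr.le hL1))
          have b1 : μ.real (ball d x (L * r)) / μ.real (ball d z s) ≤ E * (2 * C) := by
            rw [div_le_iff₀ hB]
            refine (hE x r hr).trans ?_
            have h3 : E * μ.real (ball d x r) ≤ E * μ.real (ball d z s) :=
              mul_le_mul_of_nonneg_left h1 (by linarith)
            have : 0 ≤ E * μ.real (ball d z s) := by positivity
            nlinarith
          have b2 : μ.real (ball d x (L * r)) / μ.real (ball d x r) ≤ E * (2 * C) := by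
            rw [div_le_iff₀ hQ]
            refine (hE x r hr).trans ?_
            have : 0 ≤ E * μ.real (ball d x r) := by positivity
            nlinarith
          have c1 := (le_abs_self _).trans (a1.trans (mul_le_mul_of_nonneg_left b1 hA0))
          have c2 := (neg_le_abs _).trans (a2.trans (mul_le_mul_of_nonneg_left b2 hA0))
          linarith
      have hpow : μ.real (ball d z s) ^ γ ≤ (2 * C) ^ γ * μ.real (ball d x r) ^ γ := by
        rw [← Real.mul_rpow (by positivity) hQ.le]
        exact Real.rpow_le_rpow hB.le h2 hγ.le
      have hBp : 0 ≤ μ.real (ball d z s) ^ γ := by positivity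
      have hQp : 0 ≤ μ.real (ball d x r) ^ γ := by positivity
      calc _ ≤ μ.real (ball d z s) ^ γ * D1 := mul_le_mul_of_nonneg_left hav hBp
        _ ≤ (2 * C) ^ γ * μ.real (ball d x r) ^ γ * D1 := mul_le_mul_of_nonneg_right hpow hD10
        _ = (2 * C) ^ γ * D1 * μ.real (ball d x r) ^ γ := by ring
        _ ≤ _ := mul_le_mul_of_nonneg_right hDa hQp
    | succ n ih =>
      intro z w s hs hwx hwz h1 h2
      have hB := aux_real_pos hX z hs
      by_cases h3 : μ.real (ball d x r) ≤ 2 ^ n * μ.real (ball d z s)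
      · exact ih z w s hs hwx hwz h3 h2
      push Not at h3
      have h4 : μ.real (ball d z s) ≤ μ.real (ball d x r) := by
        have : (1 : ℝ) ≤ 2 ^ n := one_le_pow₀ one_le_two
        nlinarith
      obtain ⟨s', hss, g1, g2⟩ := aux_grow hX hμtop hC1 hC z hs
      have hs' : 0 < s' := by linarith
      have hsub := aux_ball_mono (d := d) z hss
      have hB' := aux_real_pos hX z hs'
      have h5 := ih z w s' hs' hwx (hsub hwz)
        (by
          refine h1.trans ?_
          rw [pow_succ, mul_assoc]
          exact mul_le_mul_of_nonneg_left g1 (by positivity))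
        (by
          refine g2.trans ?_
          exact mul_le_mul_of_nonneg_left h4 (by positivity))
      have h6 := (le_abs_self _).trans (aux_cmp hX hg hA z z hs hs' hsub)
      have h7 : μ.real (ball d z s') / μ.real (ball d z s) ≤ 2 * C := by
        rwa [div_le_iff₀ hB]
      have h8 := mul_le_mul_of_nonneg_left h7 hA0
      have h9 : μ.real (ball d z s) ^ γ ≤ t * μ.real (ball d z s') ^ γ := by
        have e : t = ((2 : ℝ)⁻¹) ^ γ := by
          rw [ht, Real.rpow_neg (by norm_num), Real.inv_rpow (by norm_num)]
        rw [e, ← Real.mul_rpow (by positivity) hB'.le]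
        exact Real.rpow_le_rpow hB.le (by linarith) hγ.le
      have hBp : 0 ≤ μ.real (ball d z s) ^ γ := by positivity
      have hQp : 0 ≤ μ.real (ball d x r) ^ γ := by positivity
      have h10 : μ.real (ball d z s) ^ γ ≤ μ.real (ball d x r) ^ γ :=
        Real.rpow_le_rpow hB.le h4 hγ.le
      have h11 : μ.real (ball d z s) ^ γ * (avg μ (ball d z s') g - avg μ (ball d x r) g) ≤
          t * (D * μ.real (ball d x r) ^ γ) := by
        rcases le_total (avg μ (ball d z s') g - avg μ (ball d x r) g) 0 with hneg | hpos
        · refine (mul_nonpos_of_nonneg_of_nonpos hBp hneg).trans (by positivity)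
        · refine (mul_le_mul_of_nonneg_right h9 hpos).trans ?_
          rw [mul_assoc]
          exact mul_le_mul_of_nonneg_left h5 ht0.le
      have h12 : μ.real (ball d z s) ^ γ * (2 * C * A) ≤ μ.real (ball d x r) ^ γ * (2 * C * A) :=
        mul_le_mul_of_nonneg_right h10 (by positivity)
      calc μ.real (ball d z s) ^ γ * (avg μ (ball d z s) g - avg μ (ball d x r) g)
          ≤ μ.real (ball d z s) ^ γ *
              ((avg μ (ball d z s') g - avg μ (ball d x r) g) + 2 * C * A) :=
            mul_le_mul_of_nonneg_left (by linarith) hBp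
        _ ≤ t * (D * μ.real (ball d x r) ^ γ) + μ.real (ball d x r) ^ γ * (2 * C * A) := by
            rw [mul_add]; exact add_le_add h11 h12
        _ = (t * D + 2 * C * A) * μ.real (ball d x r) ^ γ := by ring
        _ ≤ _ := mul_le_mul_of_nonneg_right hDb hQp
  intro x z w r s hr hs hwx hwz hle
  have hB := aux_real_pos hX z hs
  have hQ := aux_real_pos hX x hr
  obtain ⟨n, hn⟩ := pow_unbounded_of_one_lt (μ.real (ball d x r) / μ.real (ball d z s))
    (one_lt_two)
  rw [div_lt_iff₀ hB] at hn
  exact claim x r hr n z w s hs hwx hwz hn.le (by nlinarith)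

theorem aux_anti {x y : ℝ≥0∞} {c : ℝ} (hc : c ≤ 0) (h : x ≤ y) : y ^ c ≤ x ^ c := by
  rw [← neg_neg c, ENNReal.rpow_neg, ENNReal.rpow_neg x, ENNReal.inv_le_inv]
  exact ENNReal.rpow_le_rpow h (by linarith)

def fE {X : Type*} [MeasurableSpace X] (d : X → X → ℝ) (μ : Measure X) (γ : ℝ) (f : X → ℝ)
    (x : X) : ℝ≥0∞ :=
  ⨆ (z : X) (r : ℝ) (_ : 0 < r) (_ : x ∈ ball d z r),
    μ (ball d z r) ^ (γ - 1) * ∫⁻ y in ball d z r, ENNReal.ofReal (|f y|) ∂μ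

theorem fE_ge {X : Type*} [MeasurableSpace X] (d : X → X → ℝ) (μ : Measure X) (γ : ℝ) (f : X → ℝ)
    {x z : X} {r : ℝ} (hr : 0 < r) (hx : x ∈ ball d z r) :
    μ (ball d z r) ^ (γ - 1) * ∫⁻ y in ball d z r, ENNReal.ofReal (|f y|) ∂μ ≤ fE d μ γ f x :=
  le_iSup_of_le z (le_iSup_of_le r (le_iSup_of_le hr (le_iSup_of_le hx le_rfl)))

theorem fE_mono {X : Type*} [MeasurableSpace X] (d : X → X → ℝ) (μ : Measure X) (γ : ℝ)
    {f g : X → ℝ} {β : ℝ} (hβ : 0 ≤ β) (h : ∀ y, |f y| ≤ β * |g y|) (x : X) :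
    fE d μ γ f x ≤ ENNReal.ofReal β * fE d μ γ g x := by
  refine iSup_le fun z => iSup_le fun r => iSup_le fun hr => iSup_le fun hx => ?_
  refine le_trans ?_ (mul_le_mul_right (fE_ge d μ γ g hr hx) _)
  rw [mul_left_comm, ← lintegral_const_mul' _ _ ENNReal.ofReal_ne_top]
  refine mul_le_mul_right (lintegral_mono fun y => ?_) _
  rw [← ENNReal.ofReal_mul hβ]
  exact ENNReal.ofReal_le_ofReal (h y)

theorem fE_le_bdd {X : Type*} [MeasurableSpace X] (d : X → X → ℝ) (μ : Measure X)
    {γ : ℝ} (hγ : γ ∈ Set.Ioo (0 : ℝ) 1)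
    {f : X → ℝ} {N : ℝ} {S : Set X} (hS : MeasurableSet S)
    (hSt : μ S ≠ ⊤) (h1 : ∀ y, |f y| ≤ N) (h0 : ∀ y, y ∉ S → f y = 0) (x : X) :
    fE d μ γ f x ≤ ENNReal.ofReal N * μ S ^ γ := by
  refine iSup_le fun z => iSup_le fun r => iSup_le fun hr => iSup_le fun hx => ?_
  have hint : ∫⁻ y in ball d z r, ENNReal.ofReal (|f y|) ∂μ ≤
      ENNReal.ofReal N * μ (S ∩ ball d z r) := by
    calc _ ≤ ∫⁻ y in ball d z r, S.indicator (fun _ => ENNReal.ofReal N) y ∂μ := by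
          refine lintegral_mono fun y => ?_
          by_cases hy : y ∈ S
          · simp only [Set.indicator_of_mem hy]; exact ENNReal.ofReal_le_ofReal (h1 y)
          · simp [h0 y hy]
      _ = _ := by
          rw [lintegral_indicator hS, lintegral_const, Measure.restrict_restrict hS]
          simp
  refine (mul_le_mul_right hint _).trans ?_
  rw [mul_left_comm]
  refine mul_le_mul_right ?_ _
  set t := μ (S ∩ ball d z r) with ht
  rcases eq_or_ne t 0 with h | h
  · simp [h]
  have htt : t ≠ ⊤ := ne_top_of_le_ne_top hSt (measure_mono Set.inter_subset_left)
  calc μ (ball d z r) ^ (γ - 1) * t ≤ t ^ (γ - 1) * t := by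
        refine mul_le_mul_left ?_ _
        exact aux_anti (by linarith [hγ.2])
          (measure_mono Set.inter_subset_right)
    _ = t ^ γ := by
        nth_rw 2 [← ENNReal.rpow_one t]
        rw [← ENNReal.rpow_add _ _ h htt]; simp
    _ ≤ _ := ENNReal.rpow_le_rpow (measure_mono Set.inter_subset_left) hγ.1.le

theorem aux_lint {X : Type*} [MeasurableSpace X] {d : X → X → ℝ} {μ : Measure X}
    (hX : IsSHT d μ) {b : X → ℝ} (hb : LocInt d μ b) (x : X) {r : ℝ} (hr : 0 < r) :
    ∫⁻ y in ball d x r, ENNReal.ofReal (|b y|) ∂μ =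
      ENNReal.ofReal (μ.real (ball d x r) * avg μ (ball d x r) (fun y => |b y|)) := by
  have hpos := aux_real_pos hX x hr
  rw [← ofReal_integral_eq_lintegral_ofReal (hb.2 x r hr).abs
    (Filter.Eventually.of_forall fun y => abs_nonneg _)]
  congr 1
  simp only [avg, Measure.real] at hpos ⊢
  field_simp

theorem aux_pow {X : Type*} [MeasurableSpace X] {d : X → X → ℝ} {μ : Measure X}
    (hX : IsSHT d μ) (x : X) {r : ℝ} (hr : 0 < r) (c : ℝ) :
    μ (ball d x r) ^ c = ENNReal.ofReal (μ.real (ball d x r) ^ c) := by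
  rw [← ENNReal.ofReal_rpow_of_pos (aux_real_pos hX x hr), Measure.real,
    ENNReal.ofReal_toReal (hX.ball_lt_top x r hr).ne]

theorem aux_term {X : Type*} [MeasurableSpace X] {d : X → X → ℝ} {μ : Measure X}
    (hX : IsSHT d μ) {b : X → ℝ} (hb : LocInt d μ b) (γ : ℝ) (x : X) {r : ℝ} (hr : 0 < r) :
    μ (ball d x r) ^ (γ - 1) * ∫⁻ y in ball d x r, ENNReal.ofReal (|b y|) ∂μ =
      ENNReal.ofReal (μ.real (ball d x r) ^ γ * avg μ (ball d x r) (fun y => |b y|)) := by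
  have hpos := aux_real_pos hX x hr
  rw [aux_lint hX hb x hr, aux_pow hX x hr, ← ENNReal.ofReal_mul (by positivity), ← mul_assoc]
  congr 2
  rw [Real.rpow_sub_one hpos.ne']
  field_simp

theorem aux_avg_nonneg {X : Type*} [MeasurableSpace X] (μ : Measure X) (B : Set X) (b : X → ℝ) :
    0 ≤ avg μ B (fun y => |b y|) :=
  mul_nonneg (inv_nonneg.2 ENNReal.toReal_nonneg) (integral_nonneg fun _ => abs_nonneg _)

theorem aux_bounds {X : Type*} [MeasurableSpace X] {d : X → X → ℝ} {μ : Measure X}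
    (hX : IsSHT d μ) {γ : ℝ} (hγ : γ ∈ Set.Ioo (0 : ℝ) 1) {b : X → ℝ} (hb : LocInt d μ b)
    {D : ℝ} (hD0 : 0 ≤ D)
    (hD : ∀ (x z w : X) (r s : ℝ), 0 < r → 0 < s → w ∈ ball d x r → w ∈ ball d z s →
      μ.real (ball d z s) ≤ μ.real (ball d x r) →
      μ.real (ball d z s) ^ γ * (avg μ (ball d z s) (fun y => |b y|) -
        avg μ (ball d x r) (fun y => |b y|)) ≤ D * μ.real (ball d x r) ^ γ)
    (x w : X) {r : ℝ} (hr : 0 < r) (hw : w ∈ ball d x r) :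
    (μ.real (ball d x r) ^ γ * avg μ (ball d x r) (fun y => |b y|) ≤
      fracMax d μ γ (fun y => b y * (ball d x r).indicator (fun _ => (1 : ℝ)) y) w ∧
    fracMax d μ γ (fun y => b y * (ball d x r).indicator (fun _ => (1 : ℝ)) y) w ≤
      μ.real (ball d x r) ^ γ * (avg μ (ball d x r) (fun y => |b y|) + D)) ∧
    (μ.real (ball d x r) ^ γ * avg μ (ball d x r) (fun y => |b y|) ≤
      fracMaxLoc d μ γ (ball d x r) b w ∧
    fracMaxLoc d μ γ (ball d x r) b w ≤
      μ.real (ball d x r) ^ γ * (avg μ (ball d x r) (fun y => |b y|) + D)) := by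
  set Q := ball d x r with hQd
  have hQpos := aux_real_pos hX x hr
  have hQm : MeasurableSet Q := hX.measurableSet_ball x r
  have hav := aux_avg_nonneg μ Q b
  have hle : ∀ y, |b y * Q.indicator (fun _ => (1 : ℝ)) y| ≤ |b y| := by
    intro y
    by_cases hy : y ∈ Q <;> simp [hy]
  have hon : ∀ B ⊆ Q, MeasurableSet B →
      ∫⁻ y in B, ENNReal.ofReal (|b y * Q.indicator (fun _ => (1 : ℝ)) y|) ∂μ =
      ∫⁻ y in B, ENNReal.ofReal (|b y|) ∂μ := by
    intro B hB hBm
    refine setLIntegral_congr_fun hBm fun y hy => ?_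
    simp [hB hy]
  have hlow : ENNReal.ofReal (μ.real Q ^ γ * avg μ Q (fun y => |b y|)) ≤
      ⨆ (z : X) (s : ℝ) (_ : 0 < s) (_ : w ∈ ball d z s) (_ : ball d z s ⊆ Q),
        μ (ball d z s) ^ (γ - 1) * ∫⁻ y in ball d z s, ENNReal.ofReal (|b y|) ∂μ := by
    rw [← aux_term hX hb γ x hr]
    exact le_iSup_of_le x (le_iSup_of_le r (le_iSup_of_le hr (le_iSup_of_le hw
      (le_iSup_of_le subset_rfl le_rfl))))
  have hmid : (⨆ (z : X) (s : ℝ) (_ : 0 < s) (_ : w ∈ ball d z s) (_ : ball d z s ⊆ Q),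
        μ (ball d z s) ^ (γ - 1) * ∫⁻ y in ball d z s, ENNReal.ofReal (|b y|) ∂μ) ≤
      fE d μ γ (fun y => b y * Q.indicator (fun _ => (1 : ℝ)) y) w := by
    refine iSup_le fun z => iSup_le fun s => iSup_le fun hs => iSup_le fun hz =>
      iSup_le fun hsub => ?_
    rw [← hon _ hsub (hX.measurableSet_ball z s)]
    exact fE_ge d μ γ _ hs hz
  have hhigh : fE d μ γ (fun y => b y * Q.indicator (fun _ => (1 : ℝ)) y) w ≤
      ENNReal.ofReal (μ.real Q ^ γ * (avg μ Q (fun y => |b y|) + D)) := by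
    refine iSup_le fun z => iSup_le fun s => iSup_le fun hs => iSup_le fun hz => ?_
    rcases le_total (μ (ball d z s)) (μ Q) with hc | hc
    · calc _ ≤ μ (ball d z s) ^ (γ - 1) * ∫⁻ y in ball d z s, ENNReal.ofReal (|b y|) ∂μ :=
            mul_le_mul_right (lintegral_mono fun y => ENNReal.ofReal_le_ofReal (hle y)) _
        _ = _ := aux_term hX hb γ z hs
        _ ≤ _ := by
            apply ENNReal.ofReal_le_ofReal
            have hc' : μ.real (ball d z s) ≤ μ.real Q :=
              ENNReal.toReal_mono (hX.ball_lt_top x r hr).ne hc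
            have h1 := hD x z w r s hr hs hw hz hc'
            have h2 : μ.real (ball d z s) ^ γ ≤ μ.real Q ^ γ :=
              Real.rpow_le_rpow measureReal_nonneg hc' hγ.1.le
            have h3 := mul_le_mul_of_nonneg_right h2 hav
            rw [← hQd] at h1
            linarith
    · calc _ ≤ μ Q ^ (γ - 1) * ∫⁻ y in Q, ENNReal.ofReal (|b y|) ∂μ := by
            refine mul_le_mul' (aux_anti (by linarith [hγ.2]) hc) ?_
            rw [← lintegral_indicator hQm]
            refine (setLIntegral_le_lintegral _ _).trans (lintegral_mono fun y => ?_)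
            by_cases hy : y ∈ Q <;> simp [hy]
        _ = _ := aux_term hX hb γ x hr
        _ ≤ _ := by
            apply ENNReal.ofReal_le_ofReal
            exact mul_le_mul_of_nonneg_left (by linarith) (by positivity)
  have hnn : 0 ≤ μ.real Q ^ γ * (avg μ Q (fun y => |b y|) + D) := by positivity
  have hft := ne_top_of_le_ne_top ENNReal.ofReal_ne_top hhigh
  have hlt := ne_top_of_le_ne_top hft hmid
  refine ⟨⟨?_, ?_⟩, ?_, ?_⟩
  · exact (ENNReal.ofReal_le_iff_le_toReal hft).1 (hlow.trans hmid)
  · exact ENNReal.toReal_le_of_le_ofReal hnn hhigh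
  · exact (ENNReal.ofReal_le_iff_le_toReal hlt).1 hlow
  · exact ENNReal.toReal_le_of_le_ofReal hnn (hmid.trans hhigh)

theorem aux_holder {X : Type*} [MeasurableSpace X] (ν : Measure X) {s t γ : ℝ} (hs : 0 < s)
    (hγ : 0 < γ) (ht : 0 < t) (h : 1 / s = 1 / t + γ) {f : X → ℝ≥0∞} (hf : Measurable f) :
    (∫⁻ y, f y ^ s ∂ν) ^ (1 / s) ≤ (∫⁻ y, f y ^ t ∂ν) ^ (1 / t) * ν Set.univ ^ γ := by
  have hst : s < t := by
    have : 1 / t < 1 / s := by linarith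
    exact (one_div_lt_one_div ht hs).1 this
  have := ENNReal.lintegral_Lp_mul_le_Lq_mul_Lr hs hst (r := 1 / γ) (by simpa using h) ν
    (f := f) (g := fun _ => 1) hf.aemeasurable aemeasurable_const
  simpa using this

theorem aux_mor_ge {X : Type*} [MeasurableSpace X] (d : X → X → ℝ) (μ : Measure X)
    (u v : X → ℝ) (p κ : ℝ) (f : X → ℝ) (x : X) {r : ℝ} (hr : 0 < r) :
    ((wMeas μ v (ball d x r) ^ κ)⁻¹ *
      ∫⁻ y in ball d x r, ENNReal.ofReal (|f y| ^ p * u y) ∂μ) ^ (1 / p) ≤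
      morrey2 d μ u v p κ f :=
  le_iSup_of_le x (le_iSup_of_le r (le_iSup_of_le hr le_rfl))

theorem aux_q {γ p q : ℝ} (hγ : γ ∈ Set.Ioo (0 : ℝ) 1)
    (hp : 1 < p) (hpγ : p < 1 / γ) (hq : 1 / q = 1 / p - γ) : 1 < q := by
  have h1 : γ < 1 / p := by
    rw [lt_div_iff₀ hγ.1] at hpγ
    rw [lt_div_iff₀ (by linarith)]; linarith
  have h2 : 0 < 1 / q := by linarith
  have hq0 : 0 < q := one_div_pos.1 h2
  have h3 : 1 / p < 1 := by rw [div_lt_one (by linarith)]; exact hp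
  have h4 : 1 / q < 1 := by linarith [hγ.1]
  rwa [div_lt_one hq0] at h4

theorem aux_chi {X : Type*} [MeasurableSpace X] {d : X → X → ℝ} {μ : Measure X}
    (hX : IsSHT d μ) {γ κ p q : ℝ} (hγ : γ ∈ Set.Ioo (0 : ℝ) 1)
    (hp : 1 < p) (hq1 : 1 < q) (hq : 1 / q = 1 / p - γ)
    {ω : X → ℝ} (hω : IsWeight d μ ω) {f : X → ℝ} (x : X) (r : ℝ)
    (hf : ∀ y, |f y| ≤ (ball d x r).indicator (fun _ => (1 : ℝ)) y) :
    morrey2 d μ (fun t => ω t ^ p) (fun t => ω t ^ q) p κ f ≤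
      μ (ball d x r) ^ γ * morrey d μ (fun t => ω t ^ q) q (κ * q / p)
          ((ball d x r).indicator (fun _ => (1 : ℝ))) := by
  have hp0 : 0 < p := by linarith
  have hq0 : 0 < q := by linarith
  set Q := ball d x r with hQ
  have hQm : MeasurableSet Q := hX.measurableSet_ball x r
  refine iSup_le fun z => iSup_le fun s => iSup_le fun hs => ?_
  refine le_trans ?_ (mul_le_mul_right (aux_mor_ge d μ _ _ q (κ * q / p) _ z hs) _)
  set W := wMeas μ (fun t => ω t ^ q) (ball d z s)
  have key : ∀ a : ℝ, 0 < a → ∫⁻ y in ball d z s,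
      ENNReal.ofReal (|Q.indicator (fun _ => (1 : ℝ)) y| ^ a * ω y ^ a) ∂μ =
      ∫⁻ y in Q ∩ ball d z s, ENNReal.ofReal (ω y) ^ a ∂μ := by
    intro a ha
    rw [← Measure.restrict_restrict hQm, ← lintegral_indicator hQm]
    refine lintegral_congr fun y => ?_
    by_cases hy : y ∈ Q
    · simp [hy, ENNReal.ofReal_rpow_of_nonneg (hω.1 y) ha.le]
    · simp [hy, Real.zero_rpow ha.ne']
  have h1 : ∫⁻ y in ball d z s, ENNReal.ofReal (|f y| ^ p * ω y ^ p) ∂μ ≤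
      ∫⁻ y in Q ∩ ball d z s, ENNReal.ofReal (ω y) ^ p ∂μ := by
    rw [← key p hp0]
    refine lintegral_mono fun y => ENNReal.ofReal_le_ofReal ?_
    refine mul_le_mul_of_nonneg_right ?_ (Real.rpow_nonneg (hω.1 y) _)
    exact Real.rpow_le_rpow (abs_nonneg _) ((hf y).trans (le_abs_self _)) hp0.le
  have h2 := aux_holder (μ.restrict (Q ∩ ball d z s)) hp0 hγ.1 hq0 (by linarith)
    (f := fun y => ENNReal.ofReal (ω y)) hω.2.1.ennreal_ofReal
  rw [key q hq0, ENNReal.mul_rpow_of_nonneg _ _ (by positivity),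
    ENNReal.mul_rpow_of_nonneg _ _ (by positivity)]
  have e : ((W ^ (κ * q / p))⁻¹) ^ (1 / q) = ((W ^ κ)⁻¹) ^ (1 / p) := by
    rw [ENNReal.inv_rpow, ENNReal.inv_rpow, ← ENNReal.rpow_mul, ← ENNReal.rpow_mul]
    congr 2
    field_simp
  rw [e, mul_left_comm]
  refine mul_le_mul_right ?_ _
  refine (ENNReal.rpow_le_rpow h1 (by positivity)).trans (h2.trans ?_)
  rw [mul_comm]
  refine mul_le_mul_left (ENNReal.rpow_le_rpow ?_ hγ.1.le) _
  rw [Measure.restrict_apply_univ]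
  exact measure_mono Set.inter_subset_left

theorem aux_apq {X : Type*} [MeasurableSpace X] (d : X → X → ℝ) (μ : Measure X)
    (ω : X → ℝ) (p q : ℝ) (x : X) {r : ℝ} (hr : 0 < r) :
    ((μ (ball d x r))⁻¹ * ∫⁻ y in ball d x r, ENNReal.ofReal (ω y ^ q) ∂μ) ^ (1 / q) *
      ((μ (ball d x r))⁻¹ *
        ∫⁻ y in ball d x r, ENNReal.ofReal (ω y ^ (-(p / (p - 1)))) ∂μ) ^ (1 - 1 / p) ≤
      apqConst d μ ω p q := by
  unfold apqConst
  exact le_iSup₂_of_le x r (le_iSup_of_le hr le_rfl)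

theorem aux_W_top {X : Type*} [MeasurableSpace X] {d : X → X → ℝ} {μ : Measure X}
    (hX : IsSHT d μ) {p q : ℝ} (hp : 1 < p) (hq1 : 1 < q)
    {ω : X → ℝ} (hω : IsWeight d μ ω) (hApq : MemApq d μ ω p q) (x : X) {r : ℝ} (hr : 0 < r) :
    wMeas μ (fun t => ω t ^ q) (ball d x r) ≠ ⊤ := by
  have hp0 : 0 < p := by linarith
  have hq0 : 0 < q := by linarith
  intro htop
  set B := ball d x r with hB
  have h1 : ((μ B)⁻¹ * ∫⁻ y in B, ENNReal.ofReal (ω y ^ q) ∂μ) ^ (1 / q) *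
      ((μ B)⁻¹ * ∫⁻ y in B, ENNReal.ofReal (ω y ^ (-(p / (p - 1)))) ∂μ) ^ (1 - 1 / p) < ⊤ :=
    lt_of_le_of_lt (aux_apq d μ ω p q x hr) hApq
  have hinv : (μ B)⁻¹ ≠ 0 := ENNReal.inv_ne_zero.2 (hX.ball_lt_top x r hr).ne
  have hp1 : 0 < 1 - 1 / p := by
    have : 1 / p < 1 := by rw [div_lt_one (by linarith)]; exact hp
    linarith
  have h2 : ∫⁻ y in B, ENNReal.ofReal (ω y ^ q) ∂μ = ⊤ := htop
  rw [h2, ENNReal.mul_top hinv, ENNReal.top_rpow_of_pos (by positivity)] at h1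
  have h3 : ∫⁻ y in B, ENNReal.ofReal (ω y ^ (-(p / (p - 1)))) ∂μ = 0 := by
    by_contra hne
    rw [ENNReal.top_mul] at h1
    · exact lt_irrefl _ h1
    · intro h0
      rw [ENNReal.rpow_eq_zero_iff_of_pos hp1] at h0
      exact mul_ne_zero hinv hne h0
  rw [lintegral_eq_zero_iff (by exact (hω.2.1.pow_const _).ennreal_ofReal)] at h3
  have h4 : ∫⁻ y in B, ENNReal.ofReal (ω y ^ q) ∂μ = 0 := by
    rw [lintegral_eq_zero_iff (by exact (hω.2.1.pow_const _).ennreal_ofReal)]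
    filter_upwards [h3] with y hy
    rcases (hω.1 y).eq_or_lt with h | h
    · simp [← h, Real.zero_rpow hq0.ne']
    · exfalso
      have : 0 < ω y ^ (-(p / (p - 1))) := Real.rpow_pos_of_pos h _
      simp at hy
      linarith
  rw [h2] at h4
  exact absurd h4 (by simp)

theorem aux_W_pos {X : Type*} [MeasurableSpace X] {d : X → X → ℝ} {μ : Measure X}
    (hX : IsSHT d μ) (q : ℝ)
    {ω : X → ℝ} (hω : IsWeight d μ ω) (hpos : ∀ᵐ y ∂μ, 0 < ω y) (x : X) {r : ℝ} (hr : 0 < r) :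
    wMeas μ (fun t => ω t ^ q) (ball d x r) ≠ 0 := by
  intro h
  rw [wMeas, lintegral_eq_zero_iff (by exact (hω.2.1.pow_const _).ennreal_ofReal)] at h
  have h2 : ∀ᵐ y ∂(μ.restrict (ball d x r)), False := by
    filter_upwards [h, ae_restrict_of_ae hpos] with y hy hy2
    have := Real.rpow_pos_of_pos hy2 q
    simp at hy
    linarith
  rw [Filter.eventually_false_iff_eq_bot, ae_eq_bot, Measure.restrict_eq_zero] at h2
  exact (aux_ball_pos hX x hr).ne' h2

theorem aux_chi_le {X : Type*} [MeasurableSpace X] {d : X → X → ℝ} {μ : Measure X}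
    (hX : IsSHT d μ) {p q κ : ℝ} (hp : 1 < p) (hq1 : 1 < q) (hκ0 : 0 ≤ κ) (hκ : κ ≤ 1)
    {ω : X → ℝ} (hω : IsWeight d μ ω) (hApq : MemApq d μ ω p q)
    (hpos : ∀ᵐ y ∂μ, 0 < ω y) (x : X) {r : ℝ} (hr : 0 < r) :
    morrey d μ (fun t => ω t ^ q) q κ ((ball d x r).indicator (fun _ => (1 : ℝ))) ≤
      wMeas μ (fun t => ω t ^ q) (ball d x r) ^ ((1 - κ) / q) := by
  have hq0 : 0 < q := by linarith
  refine iSup_le fun z => iSup_le fun s => iSup_le fun hs => ?_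
  set Q := ball d x r with hQ
  have hQm : MeasurableSet Q := hX.measurableSet_ball x r
  set W := wMeas μ (fun t => ω t ^ q) (ball d z s) with hW
  have hWt : W ≠ ⊤ := aux_W_top hX hp hq1 hω hApq z hs
  have hW0 : W ≠ 0 := aux_W_pos hX q hω hpos z hs
  have key : ∫⁻ y in ball d z s,
      ENNReal.ofReal (|Q.indicator (fun _ => (1 : ℝ)) y| ^ q * ω y ^ q) ∂μ =
      ∫⁻ y in Q ∩ ball d z s, ENNReal.ofReal (ω y ^ q) ∂μ := by
    rw [← Measure.restrict_restrict hQm, ← lintegral_indicator hQm]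
    refine lintegral_congr fun y => ?_
    by_cases hy : y ∈ Q
    · simp [hy]
    · simp [hy, Real.zero_rpow hq0.ne']
  rw [key]
  set t := ∫⁻ y in Q ∩ ball d z s, ENNReal.ofReal (ω y ^ q) ∂μ with ht
  have htW : t ≤ W := lintegral_mono_set Set.inter_subset_right
  have htQ : t ≤ wMeas μ (fun t => ω t ^ q) Q := lintegral_mono_set Set.inter_subset_left
  have htt : t ≠ ⊤ := ne_top_of_le_ne_top hWt htW
  rw [div_eq_mul_one_div (1 - κ) q, ENNReal.rpow_mul]
  refine ENNReal.rpow_le_rpow ?_ (by positivity)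
  refine le_trans ?_ (ENNReal.rpow_le_rpow htQ (by linarith))
  rcases eq_or_ne t 0 with h | h
  · simp [h]
  calc (W ^ κ)⁻¹ * t ≤ (t ^ κ)⁻¹ * t :=
        mul_le_mul_left (ENNReal.inv_le_inv.2 (ENNReal.rpow_le_rpow htW hκ0)) _
    _ = t ^ (1 - κ) := by
        rw [← ENNReal.rpow_neg]
        nth_rw 2 [← ENNReal.rpow_one t]
        rw [← ENNReal.rpow_add _ _ h htt]; congr 1; ring

theorem aux_trunc {X : Type*} [MeasurableSpace X] {d : X → X → ℝ} {μ : Measure X}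
    (hX : IsSHT d μ) {b : X → ℝ} (hb : LocInt d μ b) (x : X) {r : ℝ} (hr : 0 < r) :
    ∃ N : ℕ, μ.real (ball d x r) / 2 ≤ μ.real (ball d x r ∩ {y | |b y| ≤ N}) ∧
      μ.real (ball d x r) * (avg μ (ball d x r) (fun y => |b y|) - 1) ≤
        ∫ y in ball d x r ∩ {y | |b y| ≤ N}, |b y| ∂μ := by
  have hpos := aux_real_pos hX x hr
  have hQm : MeasurableSet (ball d x r) := hX.measurableSet_ball x r
  set S : ℕ → Set X := fun N => ball d x r ∩ {y | |b y| ≤ N} with hS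
  have hSm : ∀ N, MeasurableSet (S N) := fun N =>
    hQm.inter (measurableSet_le hb.1.abs measurable_const)
  have hmono : Monotone S := by
    intro a c hac y hy
    exact ⟨hy.1, (show |b y| ≤ (c : ℝ) from
      le_trans (show |b y| ≤ (a : ℝ) from hy.2) (by exact_mod_cast hac))⟩
  have hU : (⋃ N, S N) = ball d x r := by
    ext y
    simp only [Set.mem_iUnion]
    constructor
    · rintro ⟨N, hN⟩; exact hN.1
    · intro hy
      obtain ⟨N, hN⟩ := exists_nat_ge (|b y|)
      exact ⟨N, hy, hN⟩
  have t1 := tendsto_measure_iUnion_atTop (μ := μ) hmono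
  rw [hU] at t1
  have t1' := (ENNReal.tendsto_toReal (hX.ball_lt_top x r hr).ne).comp t1
  have t2 := tendsto_setIntegral_of_monotone (μ := μ) (f := fun y => |b y|) hSm hmono
    (by rw [hU]; exact (hb.2 x r hr).abs)
  rw [hU] at t2
  have e : ∫ y in ball d x r, |b y| ∂μ =
      μ.real (ball d x r) * avg μ (ball d x r) (fun y => |b y|) := by
    simp only [avg, Measure.real] at hpos ⊢
    field_simp
  have u1 := t1'.eventually_const_le (show μ.real (ball d x r) / 2 < _ by
    change _ < μ.real (ball d x r); linarith)
  have u2 := t2.eventually_const_le (show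
    μ.real (ball d x r) * (avg μ (ball d x r) (fun y => |b y|) - 1) < _ by
      rw [e]; nlinarith)
  obtain ⟨N, h1, h2⟩ := (u1.and u2).exists
  exact ⟨N, h1, h2⟩

theorem aux_bmo1 {X : Type*} [MeasurableSpace X] {d : X → X → ℝ} {μ : Measure X}
    (hX : IsSHT d μ)
    {γ κ p q : ℝ} (hγ : γ ∈ Set.Ioo (0 : ℝ) 1) (hκ : κ ∈ Set.Ioo (0 : ℝ) 1)
    (hp : 1 < p) (hq1 : 1 < q) (hq : 1 / q = 1 / p - γ) (hκ1 : κ * q / p ≤ 1)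
    {ω : X → ℝ} (hω : IsWeight d μ ω) (hApq : MemApq d μ ω p q) (hpos : ∀ᵐ y ∂μ, 0 < ω y)
    {b : X → ℝ} (hb : LocInt d μ b) {C₀ : ℝ≥0∞}
    (hbdd : ∀ f : X → ℝ, Measurable f →
      morrey2 d μ (fun t => ω t ^ p) (fun t => ω t ^ q) p κ f < ⊤ →
      morrey d μ (fun t => ω t ^ q) q (κ * q / p) (commFrac d μ γ b f) ≤
        C₀ * morrey2 d μ (fun t => ω t ^ p) (fun t => ω t ^ q) p κ f)
    (x : X) {r : ℝ} (hr : 0 < r) :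
    (∫⁻ y in ball d x r, (ENNReal.ofReal (avg μ (ball d x r) (fun y => |b y|) - 1 - b y) *
        ENNReal.ofReal (ω y)) ^ q ∂μ) ^ (1 / q) ≤
      2 * C₀ * wMeas μ (fun t => ω t ^ q) (ball d x r) ^ (1 / q) := by
  have hp0 : 0 < p := by linarith
  have hq0 : 0 < q := by linarith
  obtain ⟨N, hN1, hN2⟩ := aux_trunc hX hb x hr
  set Q := ball d x r with hQ
  have hQm : MeasurableSet Q := hX.measurableSet_ball x r
  have hm : 0 < μ.real Q := aux_real_pos hX x hr
  have hQt : μ Q ≠ ⊤ := (hX.ball_lt_top x r hr).ne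
  have hQ0 : μ Q ≠ 0 := (aux_ball_pos hX x hr).ne'
  set S := Q ∩ {y | |b y| ≤ N} with hS
  have hSm : MeasurableSet S := hQm.inter (measurableSet_le hb.1.abs measurable_const)
  have hSQ : S ⊆ Q := Set.inter_subset_left
  have hSt : μ S ≠ ⊤ := ne_top_of_le_ne_top hQt (measure_mono hSQ)
  set c := avg μ Q (fun y => |b y|) with hc
  set W := wMeas μ (fun t => ω t ^ q) Q with hW
  have hWt : W ≠ ⊤ := aux_W_top hX hp hq1 hω hApq x hr
  have hW0 : W ≠ 0 := aux_W_pos hX q hω hpos x hr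
  set κ' := κ * q / p with hκ'
  have hκ'0 : 0 ≤ κ' := by have := hκ.1; positivity
  set f : X → ℝ := S.indicator (fun _ => (1 : ℝ)) with hf
  have hfm : Measurable f := measurable_const.indicator hSm
  have hn1 : morrey2 d μ (fun t => ω t ^ p) (fun t => ω t ^ q) p κ f ≤
      μ Q ^ γ * W ^ ((1 - κ') / q) := by
    refine (aux_chi hX hγ hp hq1 hq hω x r ?_).trans (mul_le_mul_right
      (aux_chi_le hX hp hq1 hκ'0 hκ1 hω hApq hpos x hr) _)
    intro y
    by_cases hy : y ∈ S
    · simp [hf, hy, ← hQ, hSQ hy]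
    · simp only [hf, Set.indicator_of_notMem hy, abs_zero]
      exact Set.indicator_nonneg (fun _ _ => zero_le_one) _
  have hfin : morrey2 d μ (fun t => ω t ^ p) (fun t => ω t ^ q) p κ f < ⊤ := by
    refine hn1.trans_lt (ENNReal.mul_lt_top ?_ ?_)
    · exact ENNReal.rpow_lt_top_of_nonneg hγ.1.le hQt
    · exact ENNReal.rpow_lt_top_of_nonneg (div_nonneg (by linarith) hq0.le) hWt
  have hn2 := (hbdd f hfm hfin).trans (mul_le_mul_right hn1 C₀)
  have hn3 := (aux_mor_ge d μ _ _ q κ' _ x hr).trans hn2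
  rw [← hQ, ← hW] at hn3
  -- pointwise
  have hpt : ∀ w ∈ Q, μ.real Q ^ γ / 2 * (c - 1 - b w) ≤ |commFrac d μ γ b f w| := by
    intro w hw
    have hmg : 0 < μ.real Q ^ γ := by positivity
    have hpw : μ.real Q ^ (γ - 1) * μ.real Q = μ.real Q ^ γ := by
      rw [Real.rpow_sub_one hm.ne']; field_simp
    have hpw0 : 0 < μ.real Q ^ (γ - 1) := by positivity
    -- M f
    have a1 : fE d μ γ f w ≤ ENNReal.ofReal 1 * μ S ^ γ := by
      refine fE_le_bdd d μ hγ hSm hSt (fun y => ?_) (fun y hy => by simp [hf, hy]) w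
      by_cases hy : y ∈ S <;> simp [hf, hy]
    have a2 : fE d μ γ f w ≤ ENNReal.ofReal (μ.real Q ^ γ) := by
      refine a1.trans ?_
      rw [ENNReal.ofReal_one, one_mul, ← aux_pow hX x hr]
      exact ENNReal.rpow_le_rpow (measure_mono hSQ) hγ.1.le
    have a3 : fracMax d μ γ f w ≤ μ.real Q ^ γ := ENNReal.toReal_le_of_le_ofReal hmg.le a2
    have a4 : ENNReal.ofReal (μ.real Q ^ γ / 2) ≤ fE d μ γ f w := by
      refine le_trans ?_ (fE_ge d μ γ f hr hw)
      have : ∫⁻ y in ball d x r, ENNReal.ofReal (|f y|) ∂μ = μ S := by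
        have e : ∀ y, ENNReal.ofReal (|f y|) = S.indicator (fun _ => 1) y := by
          intro y
          by_cases hy : y ∈ S <;> simp [hf, hy]
        simp_rw [e]
        rw [lintegral_indicator hSm, lintegral_const, Measure.restrict_restrict hSm, ← hQ,
          Set.inter_eq_left.2 hSQ]
        simp
      rw [this, aux_pow hX x hr, ← ENNReal.ofReal_toReal hSt,
        ← ENNReal.ofReal_mul (by positivity)]
      apply ENNReal.ofReal_le_ofReal
      rw [← hQ, ← hpw]
      have := mul_le_mul_of_nonneg_left hN1 hpw0.le
      simp only [Measure.real] at this ⊢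
      linarith
    have a5 : μ.real Q ^ γ / 2 ≤ fracMax d μ γ f w :=
      (ENNReal.ofReal_le_iff_le_toReal (ne_top_of_le_ne_top ENNReal.ofReal_ne_top a2)).1 a4
    -- M (b f)
    have b1 : fE d μ γ (fun y => b y * f y) w ≤ ENNReal.ofReal N * μ S ^ γ := by
      refine fE_le_bdd d μ hγ hSm hSt (fun y => ?_) (fun y hy => by simp [hf, hy]) w
      by_cases hy : y ∈ S
      · simpa [hf, hy] using hy.2
      · simp [hf, hy]
    have b2 : fE d μ γ (fun y => b y * f y) w ≠ ⊤ := by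
      refine ne_top_of_le_ne_top ?_ b1
      exact ENNReal.mul_ne_top ENNReal.ofReal_ne_top (ENNReal.rpow_ne_top_of_nonneg hγ.1.le hSt)
    have b3 : ENNReal.ofReal (μ.real Q ^ γ * (c - 1)) ≤ fE d μ γ (fun y => b y * f y) w := by
      refine le_trans ?_ (fE_ge d μ γ _ hr hw)
      have : ∫⁻ y in ball d x r, ENNReal.ofReal (|b y * f y|) ∂μ =
          ENNReal.ofReal (∫ y in S, |b y| ∂μ) := by
        rw [ofReal_integral_eq_lintegral_ofReal ((hb.2 x r hr).mono_set hSQ).abs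
          (Filter.Eventually.of_forall fun y => abs_nonneg _)]
        have e : ∀ y, ENNReal.ofReal (|b y * f y|) =
            S.indicator (fun y => ENNReal.ofReal (|b y|)) y := by
          intro y
          by_cases hy : y ∈ S <;> simp [hf, hy]
        simp_rw [e]
        rw [lintegral_indicator hSm, Measure.restrict_restrict hSm, ← hQ,
          Set.inter_eq_left.2 hSQ]
      rw [this, aux_pow hX x hr, ← ENNReal.ofReal_mul (by positivity)]
      apply ENNReal.ofReal_le_ofReal
      rw [← hQ, ← hpw, mul_assoc]
      exact mul_le_mul_of_nonneg_left hN2 hpw0.le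
    have b4 : μ.real Q ^ γ * (c - 1) ≤ fracMax d μ γ (fun y => b y * f y) w :=
      (ENNReal.ofReal_le_iff_le_toReal b2).1 b3
    have b5 : 0 ≤ fracMax d μ γ (fun y => b y * f y) w := ENNReal.toReal_nonneg
    rcases le_total (c - 1 - b w) 0 with hneg | hnn
    · have h1 : μ.real Q ^ γ / 2 * (c - 1 - b w) ≤ 0 :=
        mul_nonpos_of_nonneg_of_nonpos (by positivity) hneg
      exact h1.trans (abs_nonneg _)
    · refine le_trans ?_ (neg_le_abs _)
      rw [commFrac]
      rcases le_total 0 (b w) with hb0 | hb0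
      · have := mul_le_mul_of_nonneg_left a3 hb0
        have h3 : 0 ≤ μ.real Q ^ γ / 2 * (c - 1 - b w) := by positivity
        linarith
      · have := mul_le_mul_of_nonpos_left a5 hb0
        nlinarith
  set k := ENNReal.ofReal (μ.real Q ^ γ / 2) with hk
  have hmg : 0 < μ.real Q ^ γ := by positivity
  have hk0 : k ≠ 0 := by rw [hk]; simpa using hmg
  have hkt : k ≠ ⊤ := ENNReal.ofReal_ne_top
  have hk2 : μ Q ^ γ = 2 * k := by
    rw [hk, aux_pow hX x hr, ← ENNReal.ofReal_ofNat 2, ← ENNReal.ofReal_mul (by norm_num)]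
    congr 1; ring
  set J := ∫⁻ y in Q, (ENNReal.ofReal (c - 1 - b y) * ENNReal.ofReal (ω y)) ^ q ∂μ with hJ
  have hJle : k ^ q * J ≤
      ∫⁻ y in Q, ENNReal.ofReal (|commFrac d μ γ b f y| ^ q * ω y ^ q) ∂μ := by
    rw [hJ, ← lintegral_const_mul' _ _ (ENNReal.rpow_ne_top_of_nonneg hq0.le hkt)]
    refine setLIntegral_mono' hQm fun y hy => ?_
    rw [← Real.mul_rpow (abs_nonneg _) (hω.1 y), ← ENNReal.ofReal_rpow_of_nonneg
      (mul_nonneg (abs_nonneg _) (hω.1 y)) hq0.le, ← ENNReal.mul_rpow_of_nonneg _ _ hq0.le,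
      ENNReal.ofReal_mul (abs_nonneg _), ← mul_assoc]
    refine ENNReal.rpow_le_rpow (mul_le_mul_left ?_ _) hq0.le
    rw [hk, ← ENNReal.ofReal_mul (by positivity)]
    exact ENNReal.ofReal_le_ofReal (hpt y hy)
  have hn4 : (W ^ (-(κ' / q))) * (k * J ^ (1 / q)) ≤ C₀ * (2 * k * W ^ ((1 - κ') / q)) := by
    rw [← hk2]
    refine le_trans (le_of_eq ?_) ((ENNReal.rpow_le_rpow (mul_le_mul_right hJle _)
      (by positivity)).trans hn3)
    rw [ENNReal.mul_rpow_of_nonneg _ _ (by positivity),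
      ENNReal.mul_rpow_of_nonneg _ _ (by positivity), ← ENNReal.rpow_mul k,
      mul_one_div_cancel hq0.ne', ENNReal.rpow_one, ← ENNReal.rpow_neg, ← ENNReal.rpow_mul]
    congr 2; ring
  have hn5 := mul_le_mul_right hn4 (W ^ (κ' / q) * k⁻¹)
  have e1 : W ^ (κ' / q) * k⁻¹ * (W ^ (-(κ' / q)) * (k * J ^ (1 / q))) = J ^ (1 / q) := by
    calc _ = (W ^ (κ' / q) * W ^ (-(κ' / q))) * (k⁻¹ * k) * J ^ (1 / q) := by ring
      _ = _ := by
        rw [← ENNReal.rpow_add _ _ hW0 hWt, ENNReal.inv_mul_cancel hk0 hkt]; simp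
  have e2 : W ^ (κ' / q) * k⁻¹ * (C₀ * (2 * k * W ^ ((1 - κ') / q))) =
      2 * C₀ * W ^ (1 / q) := by
    calc _ = 2 * C₀ * (W ^ (κ' / q) * W ^ ((1 - κ') / q)) * (k⁻¹ * k) := by ring
      _ = _ := by
        rw [← ENNReal.rpow_add _ _ hW0 hWt, ENNReal.inv_mul_cancel hk0 hkt, mul_one]
        congr 2; ring
  rwa [e1, e2] at hn5

theorem aux_bmo2 {X : Type*} [MeasurableSpace X] {d : X → X → ℝ} {μ : Measure X}
    (hX : IsSHT d μ)
    {γ p q : ℝ} (hγ : γ ∈ Set.Ioo (0 : ℝ) 1)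
    (hp : 1 < p) (hq1 : 1 < q) (hq : 1 / q = 1 / p - γ)
    {ω : X → ℝ} (hω : IsWeight d μ ω) (hpos : ∀ᵐ y ∂μ, 0 < ω y)
    {h : X → ℝ≥0∞} (hh : Measurable h) (K : ℝ≥0∞)
    (x : X) {r : ℝ} (hr : 0 < r)
    (hK : (∫⁻ y in ball d x r, (h y * ENNReal.ofReal (ω y)) ^ q ∂μ) ^ (1 / q) ≤
      K * wMeas μ (fun t => ω t ^ q) (ball d x r) ^ (1 / q)) :
    ∫⁻ y in ball d x r, h y ∂μ ≤ K * apqConst d μ ω p q * μ (ball d x r) := by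
  have hp0 : 0 < p := by linarith
  have hq0 : 0 < q := by linarith
  have hA := aux_apq d μ ω p q x hr
  set Q := ball d x r with hQ
  have hQt : μ Q ≠ ⊤ := (hX.ball_lt_top x r hr).ne
  have hQ0 : μ Q ≠ 0 := (aux_ball_pos hX x hr).ne'
  have hp1 : 0 < 1 - 1 / p := by
    have : 1 / p < 1 := by rw [div_lt_one (by linarith)]; exact hp
    linarith
  have hpc : 1 / (p / (p - 1)) = 1 - 1 / p := by
    have : p - 1 ≠ 0 := by linarith
    field_simp
  have hqc : 1 / (q / (q - 1)) = 1 - 1 / q := by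
    have : q - 1 ≠ 0 := by linarith
    field_simp
  set v : X → ℝ≥0∞ := fun y => (ENNReal.ofReal (ω y))⁻¹ with hv
  have hvm : Measurable v := hω.2.1.ennreal_ofReal.inv
  have s1 : ∫⁻ y in Q, h y ∂μ =
      ∫⁻ y in Q, ((fun y => h y * ENNReal.ofReal (ω y)) * v) y ∂μ := by
    refine lintegral_congr_ae (ae_restrict_of_ae ?_)
    filter_upwards [hpos] with y hy
    have : ENNReal.ofReal (ω y) ≠ 0 := by simpa using hy
    simp only [Pi.mul_apply, hv]
    rw [mul_assoc, ENNReal.mul_inv_cancel this ENNReal.ofReal_ne_top, mul_one]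
  have hconj : q.HolderConjugate (q / (q - 1)) := Real.HolderConjugate.conjExponent hq1
  have s2 := ENNReal.lintegral_mul_le_Lp_mul_Lq (μ.restrict Q) hconj
    (f := fun y => h y * ENNReal.ofReal (ω y)) (g := v)
    (hh.mul hω.2.1.ennreal_ofReal).aemeasurable hvm.aemeasurable
  have s3 := aux_holder (μ.restrict Q) (s := q / (q - 1)) (t := p / (p - 1)) (γ := γ)
    (div_pos hq0 (by linarith)) hγ.1 (div_pos hp0 (by linarith))
    (by rw [hpc, hqc]; linarith) hvm
  have s4 : ∫⁻ y in Q, v y ^ (p / (p - 1)) ∂μ =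
      ∫⁻ y in Q, ENNReal.ofReal (ω y ^ (-(p / (p - 1)))) ∂μ := by
    refine lintegral_congr_ae (ae_restrict_of_ae ?_)
    filter_upwards [hpos] with y hy
    rw [hv, ← ENNReal.ofReal_rpow_of_pos hy, ENNReal.inv_rpow, ENNReal.rpow_neg]
  rw [s4, hpc, Measure.restrict_apply_univ] at s3
  set P := ∫⁻ y in Q, ENNReal.ofReal (ω y ^ (-(p / (p - 1)))) ∂μ with hP
  change ((μ Q)⁻¹ * wMeas μ (fun t => ω t ^ q) Q) ^ (1 / q) * _ ≤ _ at hA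
  set W := wMeas μ (fun t => ω t ^ q) Q with hW
  set A := apqConst d μ ω p q with hAd
  have s5 : W ^ (1 / q) * P ^ (1 - 1 / p) ≤ A * μ Q ^ (1 - γ) := by
    rw [ENNReal.mul_rpow_of_nonneg _ _ (by positivity), ENNReal.mul_rpow_of_nonneg _ _ hp1.le,
      ENNReal.inv_rpow, ENNReal.inv_rpow, ← ENNReal.rpow_neg, ← ENNReal.rpow_neg] at hA
    have := mul_le_mul_left hA (μ Q ^ (1 - γ))
    refine le_trans (le_of_eq ?_) this
    calc _ = (μ Q ^ (-(1 / q) + -(1 - 1 / p) + (1 - γ))) * (W ^ (1 / q) * P ^ (1 - 1 / p)) := by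
          have : -(1 / q) + -(1 - 1 / p) + (1 - γ) = 0 := by rw [hq]; ring
          rw [this]; simp
      _ = _ := by
          rw [ENNReal.rpow_add _ _ hQ0 hQt, ENNReal.rpow_add _ _ hQ0 hQt]; ring
  rw [s1]
  calc _ ≤ _ := s2
    _ ≤ (K * W ^ (1 / q)) * (P ^ (1 - 1 / p) * μ Q ^ γ) := mul_le_mul' hK s3
    _ = K * (W ^ (1 / q) * P ^ (1 - 1 / p)) * μ Q ^ γ := by ring
    _ ≤ K * (A * μ Q ^ (1 - γ)) * μ Q ^ γ := by gcongr
    _ = K * A * (μ Q ^ (1 - γ) * μ Q ^ γ) := by ring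
    _ = _ := by rw [← ENNReal.rpow_add _ _ hQ0 hQt]; simp

theorem aux_bmo3 {X : Type*} [MeasurableSpace X] {d : X → X → ℝ} {μ : Measure X}
    (hX : IsSHT d μ) {b : X → ℝ} (hb : LocInt d μ b) {K : ℝ≥0∞} (hK : K ≠ ⊤)
    (x : X) {r : ℝ} (hr : 0 < r)
    (h : ∫⁻ y in ball d x r, ENNReal.ofReal (avg μ (ball d x r) (fun y => |b y|) - 1 - b y) ∂μ ≤
      K * μ (ball d x r)) :
    ∫ y in ball d x r, |(fun y => |b y|) y - avg μ (ball d x r) (fun y => |b y|)| ∂μ ≤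
      (2 * K.toReal + 2) * μ.real (ball d x r) := by
  set Q := ball d x r with hQ
  have hm : 0 < μ.real Q := aux_real_pos hX x hr
  have hQt : μ Q ≠ ⊤ := (hX.ball_lt_top x r hr).ne
  set c := avg μ Q (fun y => |b y|) with hc
  have hc0 : 0 ≤ c := aux_avg_nonneg μ Q b
  have hfs : IsFiniteMeasure (μ.restrict Q) := ⟨by simpa using hQt.lt_top⟩
  have hbi : Integrable b (μ.restrict Q) := hb.2 x r hr
  have hi1 : Integrable (fun y => max (c - 1 - b y) 0) (μ.restrict Q) :=
    ((integrable_const _).sub hbi).pos_part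
  have h1 : ∫ y in Q, max (c - 1 - b y) 0 ∂μ ≤ K.toReal * μ.real Q := by
    have hnn : 0 ≤ᵐ[μ.restrict Q] (fun y => max (c - 1 - b y) 0) :=
      Filter.Eventually.of_forall fun y => le_max_right _ _
    rw [integral_eq_lintegral_of_nonneg_ae hnn hi1.aestronglyMeasurable,
      Measure.real, ← ENNReal.toReal_mul]
    refine ENNReal.toReal_mono (ENNReal.mul_ne_top hK hQt) ?_
    refine le_trans (le_of_eq ?_) h
    refine lintegral_congr fun y => ?_
    rw [ENNReal.ofReal_max]; simp
  have e : ∫ y in Q, |b y| ∂μ = μ.real Q * c := by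
    simp only [hc, avg, Measure.real] at hm ⊢
    field_simp
  have h2 : ∫ y in Q, b y ∂μ ≤ μ.real Q * c := by
    rw [← e]; exact integral_mono hbi hbi.abs fun y => le_abs_self _
  have hi2 : Integrable (fun y => (b y - c) + 2 * (max (c - 1 - b y) 0 + 1)) (μ.restrict Q) :=
    (hbi.sub (integrable_const _)).add ((hi1.add (integrable_const _)).const_mul 2)
  calc _ ≤ ∫ y in Q, ((b y - c) + 2 * (max (c - 1 - b y) 0 + 1)) ∂μ := by
        refine integral_mono (hbi.abs.sub (integrable_const _)).abs hi2 fun y => ?_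
        have a1 := le_max_left (c - 1 - b y) 0
        have a2 := le_max_right (c - 1 - b y) 0
        simp only
        refine abs_le.2 ⟨?_, ?_⟩
        · have := le_abs_self (b y)
          linarith
        · rcases abs_cases (b y) with ⟨h, _⟩ | ⟨h, _⟩ <;> rw [h] <;> linarith
    _ = (∫ y in Q, b y ∂μ - μ.real Q * c) +
          2 * (∫ y in Q, max (c - 1 - b y) 0 ∂μ + μ.real Q) := by
        have hi3 : Integrable (fun y => b y - c) (μ.restrict Q) := hbi.sub (integrable_const _)
        have hi4 : Integrable (fun y => 2 * (max (c - 1 - b y) 0 + 1)) (μ.restrict Q) :=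
          (hi1.add (integrable_const _)).const_mul 2
        rw [integral_add hi3 hi4, integral_sub hbi (integrable_const _),
          integral_const_mul, integral_add hi1 (integrable_const _)]
        simp [measureReal_restrict_apply_univ]
    _ ≤ _ := by linarith

theorem aux_null {X : Type*} [MeasurableSpace X] (d : X → X → ℝ) (μ : Measure X)
    {ω : X → ℝ} {p : ℝ} (hp : 0 < p) (v : X → ℝ) (κ : ℝ) {f : X → ℝ}
    (h : ∀ᵐ y ∂μ, ω y = 0 ∨ f y = 0) :
    morrey2 d μ (fun t => ω t ^ p) v p κ f = 0 := by
  refine le_antisymm ?_ bot_le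
  refine iSup_le fun z => iSup_le fun s => iSup_le fun hs => ?_
  have : ∫⁻ y in ball d z s, ENNReal.ofReal (|f y| ^ p * ω y ^ p) ∂μ = 0 := by
    rw [lintegral_congr_ae (g := fun _ => 0) (ae_restrict_of_ae ?_)]
    · simp
    · filter_upwards [h] with y hy
      rcases hy with hy | hy <;> simp [hy, Real.zero_rpow hp.ne']
  rw [this, mul_zero, ENNReal.zero_rpow_of_pos (by positivity)]

theorem aux_top {X : Type*} [MeasurableSpace X] {d : X → X → ℝ} {μ : Measure X}
    (hX : IsSHT d μ) (hatom : ∀ x : X, μ {x} = 0) {p q κ : ℝ} (hp : 1 < p) (hq1 : 1 < q)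
    (hκ : 1 < κ)
    {ω : X → ℝ} (hω : IsWeight d μ ω) (hApq : MemApq d μ ω p q)
    (hpos : ∀ᵐ y ∂μ, 0 < ω y) (x : X) {r : ℝ} (hr : 0 < r) :
    morrey d μ (fun t => ω t ^ q) q κ ((ball d x r).indicator (fun _ => (1 : ℝ))) = ⊤ := by
  have hq0 : 0 < q := by linarith
  set ν := μ.withDensity (fun t => ENNReal.ofReal (ω t ^ q)) with hν
  have hνB : ∀ s, wMeas μ (fun t => ω t ^ q) (ball d x s) = ν (ball d x s) := fun s => by
    rw [hν, withDensity_apply _ (hX.measurableSet_ball x s)]; rfl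
  set S : ℕ → Set X := fun n => ball d x (r / (n + 1)) with hS
  have hrn : ∀ n : ℕ, 0 < r / ((n : ℝ) + 1) := fun n => by positivity
  have hanti : Antitone S := by
    intro a c hac
    apply aux_ball_mono
    gcongr
  have hI : (⋂ n, S n) = {x} := by
    ext y
    simp only [Set.mem_iInter, Set.mem_singleton_iff]
    constructor
    · intro h
      have h0 : d x y ≤ 0 := by
        refine le_of_forall_pos_le_add fun ε hε => ?_
        obtain ⟨n, hn⟩ := exists_nat_gt (r / ε)
        have h1 : d x y < r / (n + 1) := h n
        have h2 : r / ((n : ℝ) + 1) ≤ ε := by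
          rw [div_lt_iff₀ hε] at hn
          rw [div_le_iff₀ (by positivity)]
          nlinarith
        linarith
      exact ((hX.eq_zero_iff x y).1 (le_antisymm h0 (hX.nonneg x y))).symm
    · rintro rfl n
      change d y y < _
      rw [(hX.eq_zero_iff y y).2 rfl]
      exact hrn n
  have ht : Filter.Tendsto (ν ∘ S) Filter.atTop (nhds 0) := by
    have := tendsto_measure_iInter_atTop (μ := ν) (s := S)
      (fun n => (hX.measurableSet_ball _ _).nullMeasurableSet) hanti
      ⟨0, by rw [hS]; simp only; rw [← hνB]; exact aux_W_top hX hp hq1 hω hApq x (hrn 0)⟩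
    rw [hI] at this
    have h0 : ν {x} = 0 := withDensity_absolutelyContinuous _ _ (hatom x)
    rwa [h0] at this
  have ht2 : Filter.Tendsto (fun n => ν (S n) ^ ((1 - κ) / q)) Filter.atTop (nhds ⊤) := by
    have hc := (ENNReal.continuous_rpow_const (y := (1 - κ) / q)).tendsto 0
    rw [ENNReal.zero_rpow_of_neg (div_neg_of_neg_of_pos (by linarith) hq0)] at hc
    exact hc.comp ht
  refine le_antisymm le_top (le_of_tendsto' ht2 fun n => ?_)
  refine le_trans (le_of_eq ?_) (aux_mor_ge d μ _ _ q κ _ x (hrn n))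
  have e : ∫⁻ y in ball d x (r / (n + 1)), ENNReal.ofReal
      (|(ball d x r).indicator (fun _ => (1 : ℝ)) y| ^ q * ω y ^ q) ∂μ = ν (S n) := by
    rw [← hνB]
    refine setLIntegral_congr_fun (hX.measurableSet_ball _ _) fun y hy => ?_
    have : y ∈ ball d x r := aux_ball_mono x (by
      rw [div_le_iff₀ (by positivity)]
      have : (0:ℝ) ≤ n := n.cast_nonneg
      nlinarith) hy
    simp [this]
  rw [e, hνB]
  change _ = ((ν (S n) ^ κ)⁻¹ * ν (S n)) ^ (1 / q)
  have h0 : ν (S n) ≠ 0 := by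
    rw [hS]; simp only; rw [← hνB]; exact aux_W_pos hX q hω hpos x (hrn n)
  have h1 : ν (S n) ≠ ⊤ := by
    rw [hS]; simp only; rw [← hνB]; exact aux_W_top hX hp hq1 hω hApq x (hrn n)
  rw [← ENNReal.rpow_neg]
  nth_rw 3 [← ENNReal.rpow_one (ν (S n))]
  rw [← ENNReal.rpow_add _ _ h0 h1, ← ENNReal.rpow_mul]
  congr 1; ring

theorem aux_pos {X : Type*} [MeasurableSpace X] {d : X → X → ℝ} {μ : Measure X}
    (hX : IsSHT d μ) (hμtop : μ Set.univ = ⊤)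
    {γ κ p q : ℝ} (hγ : γ ∈ Set.Ioo (0 : ℝ) 1) (hκ : κ ∈ Set.Ioo (0 : ℝ) 1)
    (hp : 1 < p) (hq1 : 1 < q) (hq : 1 / q = 1 / p - γ) (hκ1 : κ * q / p ≤ 1)
    {ω : X → ℝ} (hω : IsWeight d μ ω) (hApq : MemApq d μ ω p q) (hpos : ∀ᵐ y ∂μ, 0 < ω y)
    {b : X → ℝ} (hb : LocInt d μ b) {C₀ : ℝ≥0∞} (hC₀ : C₀ ≠ ⊤)
    (hbdd : ∀ f : X → ℝ, Measurable f →
      morrey2 d μ (fun t => ω t ^ p) (fun t => ω t ^ q) p κ f < ⊤ →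
      morrey d μ (fun t => ω t ^ q) q (κ * q / p) (commFrac d μ γ b f) ≤
        C₀ * morrey2 d μ (fun t => ω t ^ p) (fun t => ω t ^ q) p κ f) :
    ∃ D : ℝ, 0 ≤ D ∧ ∀ (x z w : X) (r s : ℝ), 0 < r → 0 < s → w ∈ ball d x r → w ∈ ball d z s →
      μ.real (ball d z s) ≤ μ.real (ball d x r) →
      μ.real (ball d z s) ^ γ * (avg μ (ball d z s) (fun y => |b y|) -
        avg μ (ball d x r) (fun y => |b y|)) ≤ D * μ.real (ball d x r) ^ γ := by
  set K := 2 * C₀ * apqConst d μ ω p q with hK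
  have hKt : K ≠ ⊤ := ENNReal.mul_ne_top (ENNReal.mul_ne_top (by simp) hC₀) hApq.ne
  refine aux_key hX hμtop hγ.1 (g := fun y => |b y|) (A := 2 * K.toReal + 2)
    ⟨hb.1.abs, fun x r hr => (hb.2 x r hr).abs⟩ (by positivity) fun x r hr => ?_
  refine aux_bmo3 hX hb hKt x hr ?_
  refine aux_bmo2 hX hγ hp hq1 hq hω hpos ?_ (2 * C₀) x hr
    (aux_bmo1 hX hγ hκ hp hq1 hq hκ1 hω hApq hpos hb hbdd x hr)
  exact (measurable_const.sub hb.1).ennreal_ofReal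

theorem aux_final {X : Type*} [MeasurableSpace X] {d : X → X → ℝ} {μ : Measure X}
    (hX : IsSHT d μ)
    {γ κ p q : ℝ} (hγ : γ ∈ Set.Ioo (0 : ℝ) 1) (hκ : κ ∈ Set.Ioo (0 : ℝ) 1)
    (hp : 1 < p) (hq1 : 1 < q) (hq : 1 / q = 1 / p - γ) (hκ1 : κ * q / p ≤ 1)
    {ω : X → ℝ} (hω : IsWeight d μ ω) (hApq : MemApq d μ ω p q) (hpos : ∀ᵐ y ∂μ, 0 < ω y)
    {b : X → ℝ} (hb : LocInt d μ b) {C₀ : ℝ≥0∞}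
    (hbdd : ∀ f : X → ℝ, Measurable f →
      morrey2 d μ (fun t => ω t ^ p) (fun t => ω t ^ q) p κ f < ⊤ →
      morrey d μ (fun t => ω t ^ q) q (κ * q / p) (commFrac d μ γ b f) ≤
        C₀ * morrey2 d μ (fun t => ω t ^ p) (fun t => ω t ^ q) p κ f)
    {D : ℝ} (hD0 : 0 ≤ D)
    (hD : ∀ (x z w : X) (r s : ℝ), 0 < r → 0 < s → w ∈ ball d x r → w ∈ ball d z s →
      μ.real (ball d z s) ≤ μ.real (ball d x r) →
      μ.real (ball d z s) ^ γ * (avg μ (ball d z s) (fun y => |b y|) -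
        avg μ (ball d x r) (fun y => |b y|)) ≤ D * μ.real (ball d x r) ^ γ)
    (x : X) (r : ℝ) (hr : 0 < r) :
      morrey d μ (fun t => ω t ^ q) q (κ * q / p)
          ((ball d x r).indicator
            (fun t => b t -
              (μ (ball d x r)).toReal ^ (-γ) *
                fracMaxLoc d μ γ (ball d x r) b t)) ≤
        (2 * C₀ + ENNReal.ofReal (4 * D)) * morrey d μ (fun t => ω t ^ q) q (κ * q / p)
          ((ball d x r).indicator (fun _ => (1 : ℝ))) := by
  have hp0 : 0 < p := by linarith
  have hq0 : 0 < q := by linarith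
  have hbnd := fun w => aux_bounds hX hγ hb hD0 hD x w hr
  change _ ≤ _ * morrey d μ (fun t => ω t ^ q) q (κ * q / p)
    ((ball d x r).indicator (fun _ => (1 : ℝ)))
  set Q := ball d x r with hQ
  have hQm : MeasurableSet Q := hX.measurableSet_ball x r
  have hm : 0 < μ.real Q := aux_real_pos hX x hr
  have hQt : μ Q ≠ ⊤ := (hX.ball_lt_top x r hr).ne
  have hQ0 : μ Q ≠ 0 := (aux_ball_pos hX x hr).ne'
  set χ : X → ℝ := Q.indicator (fun _ => (1 : ℝ)) with hχ
  have hχm : Measurable χ := measurable_const.indicator hQm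
  have hmg : 0 < μ.real Q ^ γ := by positivity
  have hκ'0 : 0 ≤ κ * q / p := by have := hκ.1; positivity
  have hNt : morrey d μ (fun t => ω t ^ q) q (κ * q / p) χ < ⊤ := by
    refine (aux_chi_le hX hp hq1 hκ'0 hκ1 hω hApq hpos x hr).trans_lt ?_
    exact ENNReal.rpow_lt_top_of_nonneg (div_nonneg (by linarith) hq0.le)
      (aux_W_top hX hp hq1 hω hApq x hr)
  have hn1 := aux_chi (κ := κ) hX hγ hp hq1 hq hω (f := χ) x r
    (fun y => by by_cases hy : y ∈ Q <;> simp [hχ, hy, ← hQ])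
  have hn2 := hbdd χ hχm (hn1.trans_lt (ENNReal.mul_lt_top
    (ENNReal.rpow_lt_top_of_nonneg hγ.1.le hQt) hNt))
  have hn3 := hn2.trans (mul_le_mul_right hn1 C₀)
  rw [← hQ, ← hχ] at hn3
  set N := morrey d μ (fun t => ω t ^ q) q (κ * q / p) χ with hN
  -- fracMax of the indicator
  have hMχ : ∀ w ∈ Q, fracMax d μ γ χ w = μ.real Q ^ γ := by
    intro w hw
    have a1 : fE d μ γ χ w ≤ ENNReal.ofReal 1 * μ Q ^ γ := by
      refine fE_le_bdd d μ hγ hQm hQt (fun y => ?_) (fun y hy => by simp [hχ, hy]) w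
      by_cases hy : y ∈ Q <;> simp [hχ, hy]
    have a2 : μ Q ^ γ ≤ fE d μ γ χ w := by
      refine le_trans (le_of_eq ?_) (fE_ge d μ γ χ hr hw)
      have : ∫⁻ y in ball d x r, ENNReal.ofReal (|χ y|) ∂μ = μ Q := by
        rw [setLIntegral_congr_fun hQm (g := fun _ => 1) (fun y hy => by simp [hχ, hy])]
        simp [← hQ]
      rw [this, ← hQ]
      nth_rw 3 [← ENNReal.rpow_one (μ Q)]
      rw [← ENNReal.rpow_add _ _ hQ0 hQt]; simp
    have a3 : fE d μ γ χ w = μ Q ^ γ := le_antisymm (by simpa using a1) a2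
    change (fE d μ γ χ w).toReal = _
    rw [a3, ← ENNReal.toReal_rpow]; rfl
  set c := avg μ Q (fun y => |b y|) with hc
  set F : X → ℝ := Q.indicator (fun t => b t - (μ Q).toReal ^ (-γ) * fracMaxLoc d μ γ Q b t)
    with hF
  set G := commFrac d μ γ b χ with hG
  have hpt : ∀ y, |F y| ≤ μ.real Q ^ (-γ) * |G y| + 2 * D * χ y := by
    intro y
    by_cases hy : y ∈ Q
    · simp only [hF, hχ, Set.indicator_of_mem hy]
      obtain ⟨⟨h1, h2⟩, h3, h4⟩ := hbnd y hy
      have hinv : μ.real Q ^ (-γ) * μ.real Q ^ γ = 1 := by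
        rw [← Real.rpow_add hm]; simp
      have hi0 : 0 < μ.real Q ^ (-γ) := by positivity
      rw [← abs_of_pos hi0, ← abs_mul, hG, commFrac, hMχ y hy]
      change |b y - μ.real Q ^ (-γ) * _| ≤ _
      set P := fracMax d μ γ (fun y => b y * χ y) y with hP
      set L := fracMaxLoc d μ γ Q b y with hL
      have g1 := mul_le_mul_of_nonneg_left h1 hi0.le
      have g2 := mul_le_mul_of_nonneg_left h2 hi0.le
      have g3 := mul_le_mul_of_nonneg_left h3 hi0.le
      have g4 := mul_le_mul_of_nonneg_left h4 hi0.le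
      rw [← mul_assoc, hinv, one_mul] at g1 g2 g3 g4
      have e : μ.real Q ^ (-γ) * (b y * μ.real Q ^ γ - P) = b y - μ.real Q ^ (-γ) * P := by
        linear_combination (b y) * hinv
      rw [e]
      have k1 := le_abs_self (b y - μ.real Q ^ (-γ) * P)
      have k2 := neg_le_abs (b y - μ.real Q ^ (-γ) * P)
      refine abs_le.2 ⟨by linarith, by linarith⟩
    · simp only [hF, hχ, Set.indicator_of_notMem hy, abs_zero, mul_zero, add_zero]
      positivity
  set k := ENNReal.ofReal (μ.real Q ^ (-γ)) with hk
  have hkμ : k * μ Q ^ γ = 1 := by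
    rw [hk, ← aux_pow hX x hr, ← ENNReal.rpow_add _ _ hQ0 hQt]; simp
  have hpt2 : ∀ y, ENNReal.ofReal (|F y| ^ q * ω y ^ q) ≤
      (2 * k) ^ q * ENNReal.ofReal (|G y| ^ q * ω y ^ q) +
      (ENNReal.ofReal (4 * D)) ^ q * ENNReal.ofReal (|χ y| ^ q * ω y ^ q) := by
    intro y
    have hχ0 : 0 ≤ χ y := Set.indicator_nonneg (fun _ _ => zero_le_one) _
    have cv : ∀ t : ℝ, ENNReal.ofReal (|t| ^ q * ω y ^ q) =
        (ENNReal.ofReal |t| * ENNReal.ofReal (ω y)) ^ q := by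
      intro t
      rw [← Real.mul_rpow (abs_nonneg _) (hω.1 y), ← ENNReal.ofReal_rpow_of_nonneg
        (mul_nonneg (abs_nonneg _) (hω.1 y)) hq0.le, ENNReal.ofReal_mul (abs_nonneg _)]
    rw [cv, cv, cv, ← ENNReal.mul_rpow_of_nonneg _ _ hq0.le,
      ← ENNReal.mul_rpow_of_nonneg _ _ hq0.le]
    have h1 : ENNReal.ofReal |F y| ≤ k * ENNReal.ofReal |G y| +
        ENNReal.ofReal (2 * D) * ENNReal.ofReal |χ y| := by
      rw [hk, ← ENNReal.ofReal_mul (by positivity), ← ENNReal.ofReal_mul (by positivity),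
        ← ENNReal.ofReal_add (by positivity) (by positivity), abs_of_nonneg hχ0]
      exact ENNReal.ofReal_le_ofReal (hpt y)
    have h2 : ENNReal.ofReal |F y| ≤ max (2 * k * ENNReal.ofReal |G y|)
        (ENNReal.ofReal (4 * D) * ENNReal.ofReal |χ y|) := by
      refine h1.trans ?_
      have e4 : ENNReal.ofReal (4 * D) = 2 * ENNReal.ofReal (2 * D) := by
        rw [← ENNReal.ofReal_ofNat 2, ← ENNReal.ofReal_mul (by norm_num)]; congr 1; ring
      rw [e4, mul_assoc, mul_assoc 2]
      rcases le_total (k * ENNReal.ofReal |G y|)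
        (ENNReal.ofReal (2 * D) * ENNReal.ofReal |χ y|) with h | h
      · refine le_max_of_le_right ?_
        exact (add_le_add h le_rfl).trans (two_mul _).ge
      · refine le_max_of_le_left ?_
        exact (add_le_add le_rfl h).trans (two_mul _).ge
    rcases le_max_iff.1 h2 with h | h
    · refine le_add_of_le_of_nonneg ?_ bot_le
      rw [← mul_assoc]
      exact ENNReal.rpow_le_rpow (mul_le_mul_left h _) hq0.le
    · refine le_add_of_nonneg_of_le bot_le ?_
      rw [← mul_assoc]
      exact ENNReal.rpow_le_rpow (mul_le_mul_left h _) hq0.le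
  have hfin : morrey d μ (fun t => ω t ^ q) q (κ * q / p) F ≤
      2 * k * morrey d μ (fun t => ω t ^ q) q (κ * q / p) G + ENNReal.ofReal (4 * D) * N := by
    refine iSup_le fun z => iSup_le fun s => iSup_le fun hs => ?_
    refine le_trans ?_ (add_le_add
      (mul_le_mul_right (aux_mor_ge d μ (fun t => ω t ^ q) (fun t => ω t ^ q) q (κ * q / p) G z hs) _)
      (mul_le_mul_right (aux_mor_ge d μ (fun t => ω t ^ q) (fun t => ω t ^ q) q (κ * q / p) χ z hs) _))
    set V := (wMeas μ (fun t => ω t ^ q) (ball d z s) ^ (κ * q / p))⁻¹ with hV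
    have hmeas : Measurable (fun y => (ENNReal.ofReal (4 * D)) ^ q *
        ENNReal.ofReal (|χ y| ^ q * ω y ^ q)) :=
      (((hχm.abs.pow_const q).mul (hω.2.1.pow_const q)).ennreal_ofReal).const_mul _
    have i1 := lintegral_mono (μ := μ.restrict (ball d z s)) hpt2
    rw [lintegral_add_right _ hmeas,
      lintegral_const_mul' _ _ (ENNReal.rpow_ne_top_of_nonneg hq0.le
        (ENNReal.mul_ne_top (by simp) ENNReal.ofReal_ne_top)),
      lintegral_const_mul' _ _ (ENNReal.rpow_ne_top_of_nonneg hq0.le ENNReal.ofReal_ne_top)] at i1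
    refine (ENNReal.rpow_le_rpow (mul_le_mul_right i1 V) (by positivity)).trans ?_
    rw [mul_add]
    refine (ENNReal.rpow_add_le_add_rpow _ _ (by positivity)
      (by rw [div_le_one hq0]; exact hq1.le)).trans ?_
    rw [mul_left_comm V, mul_left_comm V, ENNReal.mul_rpow_of_nonneg _ _ (by positivity),
      ENNReal.mul_rpow_of_nonneg (_ ^ q) _ (by positivity), ← ENNReal.rpow_mul,
      ← ENNReal.rpow_mul, mul_one_div_cancel hq0.ne', ENNReal.rpow_one, ENNReal.rpow_one]
  refine hfin.trans ?_
  calc _ ≤ 2 * k * (C₀ * (μ Q ^ γ * N)) + ENNReal.ofReal (4 * D) * N := by gcongr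
    _ = 2 * C₀ * (k * μ Q ^ γ) * N + ENNReal.ofReal (4 * D) * N := by ring
    _ = _ := by rw [hkμ]; ring

theorem aux_mix1 {X : Type*} [MeasurableSpace X] {d : X → X → ℝ} {μ : Measure X}
    (hX : IsSHT d μ)
    {γ κ p q : ℝ} (hγ : γ ∈ Set.Ioo (0 : ℝ) 1) (hκ : κ ∈ Set.Ioo (0 : ℝ) 1)
    (hp : 1 < p) (hq1 : 1 < q)
    {ω : X → ℝ} (hω : IsWeight d μ ω) (hApq : MemApq d μ ω p q)
    {b : X → ℝ} (hb : LocInt d μ b) {C₀ : ℝ≥0∞}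
    (hbdd : ∀ f : X → ℝ, Measurable f →
      morrey2 d μ (fun t => ω t ^ p) (fun t => ω t ^ q) p κ f < ⊤ →
      morrey d μ (fun t => ω t ^ q) q (κ * q / p) (commFrac d μ γ b f) ≤
        C₀ * morrey2 d μ (fun t => ω t ^ p) (fun t => ω t ^ q) p κ f)
    (α β : ℝ) (hZ : μ {y | ω y = 0 ∧ α ≤ |b y| ∧ |b y| ≤ β} ≠ 0) :
    ∀ᵐ y ∂μ, 0 < ω y → α ≤ b y ∧ b y ≤ β := by
  have hp0 : 0 < p := by linarith
  have hq0 : 0 < q := by linarith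
  have hκ'0 : 0 < κ * q / p := by have := hκ.1; positivity
  set Z : Set X := {y | ω y = 0 ∧ α ≤ |b y| ∧ |b y| ≤ β} with hZd
  have hZm : MeasurableSet Z :=
    (hω.2.1 (measurableSet_singleton 0)).inter
      ((measurableSet_le measurable_const hb.1.abs).inter
        (measurableSet_le hb.1.abs measurable_const))
  obtain ⟨x₀, -⟩ := nonempty_of_measure_ne_zero hZ
  have hU := aux_union (d := d) x₀ (one_pos)
  have hn : ∃ n : ℕ, μ (Z ∩ ball d x₀ (2 ^ n * 1)) ≠ 0 := by
    by_contra! hcon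
    apply hZ
    rw [← Set.inter_univ Z, ← hU, Set.inter_iUnion]
    exact measure_iUnion_null hcon
  obtain ⟨n, hn⟩ := hn
  set F := Z ∩ ball d x₀ (2 ^ n * 1) with hF
  have hFm : MeasurableSet F := hZm.inter (hX.measurableSet_ball _ _)
  have hFt : μ F ≠ ⊤ := ne_top_of_le_ne_top (hX.ball_lt_top x₀ (2 ^ n * 1) (by positivity)).ne
    (measure_mono Set.inter_subset_right)
  have hFZ : ∀ y ∈ F, ω y = 0 ∧ α ≤ |b y| ∧ |b y| ≤ β := fun y hy => hy.1
  have hβ : 0 ≤ β := by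
    obtain ⟨y, hy⟩ := nonempty_of_measure_ne_zero hn
    exact (abs_nonneg _).trans (hFZ y hy).2.2
  set f : X → ℝ := F.indicator (fun _ => (1 : ℝ)) with hf
  have hfm : Measurable f := measurable_const.indicator hFm
  have hn0 : morrey2 d μ (fun t => ω t ^ p) (fun t => ω t ^ q) p κ f = 0 := by
    refine aux_null d μ hp0 _ _ (Filter.Eventually.of_forall fun y => ?_)
    by_cases hy : y ∈ F
    · exact Or.inl (hFZ y hy).1
    · exact Or.inr (by simp [hf, hy])
  have hc0 := hbdd f hfm (by rw [hn0]; exact ENNReal.zero_lt_top)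
  rw [hn0, mul_zero] at hc0
  have key : ∀ m : ℕ, n ≤ m → ∀ᵐ y ∂(μ.restrict (ball d x₀ (2 ^ m * 1))),
      0 < ω y → α ≤ b y ∧ b y ≤ β := by
    intro m hnm
    have hR : (0:ℝ) < 2 ^ m * 1 := by positivity
    have hW := aux_W_top hX hp hq1 hω hApq x₀ hR
    have h1 := (aux_mor_ge d μ _ _ q (κ * q / p) (commFrac d μ γ b f) x₀ hR).trans hc0
    have hBp := aux_pow hX x₀ hR (γ - 1)
    have hmB := aux_real_pos hX x₀ hR
    have hFB : F ⊆ ball d x₀ (2 ^ m * 1) := Set.inter_subset_right.trans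
      (aux_ball_mono x₀ (by gcongr; norm_num))
    have hge := fun w => fE_ge d μ γ f (x := w) (z := x₀) hR
    have hBm : MeasurableSet (ball d x₀ (2 ^ m * 1)) := hX.measurableSet_ball _ _
    set B := ball d x₀ (2 ^ m * 1) with hB
    have h2 : ∫⁻ y in B, ENNReal.ofReal (|commFrac d μ γ b f y| ^ q * ω y ^ q) ∂μ = 0 := by
      have h1' := le_antisymm h1 bot_le
      rw [ENNReal.rpow_eq_zero_iff_of_pos (by positivity), mul_eq_zero] at h1'
      rcases h1' with h | h
      · rw [ENNReal.inv_eq_zero] at h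
        exact absurd h (ENNReal.rpow_ne_top_of_nonneg hκ'0.le hW)
      · exact h
    have hFr : 0 < μ.real F := ENNReal.toReal_pos hn hFt
    set c := μ.real B ^ (γ - 1) * μ.real F with hc
    have hcpos : 0 < c := by positivity
    have hpt : ∀ w ∈ B, c * max (b w - β) (α - b w) ≤ |commFrac d μ γ b f w| := by
      intro w hw
      have a1 : fE d μ γ f w ≤ ENNReal.ofReal 1 * μ F ^ γ := by
        refine fE_le_bdd d μ hγ hFm hFt (fun y => ?_) (fun y hy => by simp [hf, hy]) w
        by_cases hy : y ∈ F <;> simp [hf, hy]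
      have a2 : fE d μ γ f w ≠ ⊤ := ne_top_of_le_ne_top (ENNReal.mul_ne_top
        ENNReal.ofReal_ne_top (ENNReal.rpow_ne_top_of_nonneg hγ.1.le hFt)) a1
      have a4 : ENNReal.ofReal c ≤ fE d μ γ f w := by
        refine le_trans ?_ (hge w hw)
        have : ∫⁻ y in B, ENNReal.ofReal (|f y|) ∂μ = μ F := by
          have e : ∀ y, ENNReal.ofReal (|f y|) = F.indicator (fun _ => 1) y := by
            intro y
            by_cases hy : y ∈ F <;> simp [hf, hy]
          simp_rw [e]
          rw [lintegral_indicator hFm, lintegral_const, Measure.restrict_restrict hFm,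
            Set.inter_eq_left.2 hFB]
          simp
        rw [this, hBp, ← ENNReal.ofReal_toReal hFt, ← ENNReal.ofReal_mul (by positivity)]
        rfl
      have a5 : c ≤ fracMax d μ γ f w := (ENNReal.ofReal_le_iff_le_toReal a2).1 a4
      have b1 : fE d μ γ (fun y => b y * f y) w ≤ ENNReal.ofReal β * fE d μ γ f w := by
        refine fE_mono d μ γ hβ (fun y => ?_) w
        by_cases hy : y ∈ F
        · simpa [hf, hy] using (hFZ y hy).2.2
        · simp [hf, hy]
      have b2 : fE d μ γ (fun y => b y * f y) w ≠ ⊤ :=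
        ne_top_of_le_ne_top (ENNReal.mul_ne_top ENNReal.ofReal_ne_top a2) b1
      have b3 : fracMax d μ γ (fun y => b y * f y) w ≤ β * fracMax d μ γ f w := by
        have := ENNReal.toReal_mono (ENNReal.mul_ne_top ENNReal.ofReal_ne_top a2) b1
        rwa [ENNReal.toReal_mul, ENNReal.toReal_ofReal hβ] at this
      have b5 : 0 ≤ fracMax d μ γ (fun y => b y * f y) w := ENNReal.toReal_nonneg
      have b4 : α * fracMax d μ γ f w ≤ fracMax d μ γ (fun y => b y * f y) w := by
        rcases le_or_gt α 0 with hα | hα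
        · exact (mul_nonpos_of_nonpos_of_nonneg hα (hcpos.le.trans a5)).trans b5
        · have c1 : fE d μ γ f w ≤ ENNReal.ofReal α⁻¹ * fE d μ γ (fun y => b y * f y) w := by
            refine fE_mono d μ γ (inv_nonneg.2 hα.le) (fun y => ?_) w
            by_cases hy : y ∈ F
            · have := (hFZ y hy).2.1
              simp only [hf, hy, Set.indicator_of_mem, mul_one, abs_one]
              rwa [← div_eq_inv_mul, one_le_div hα]
            · simp [hf, hy]
          have := ENNReal.toReal_mono (ENNReal.mul_ne_top ENNReal.ofReal_ne_top b2) c1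
          rw [ENNReal.toReal_mul, ENNReal.toReal_ofReal (inv_nonneg.2 hα.le)] at this
          change fracMax d μ γ f w ≤ α⁻¹ * fracMax d μ γ (fun y => b y * f y) w at this
          rwa [← div_eq_inv_mul, le_div_iff₀ hα, mul_comm] at this
      rw [mul_max_of_nonneg _ _ hcpos.le]
      refine max_le ?_ ?_
      · rcases le_total (b w - β) 0 with h | h
        · exact (mul_nonpos_of_nonneg_of_nonpos hcpos.le h).trans (abs_nonneg _)
        · refine le_trans ?_ (le_abs_self _)
          rw [commFrac]
          nlinarith [mul_le_mul_of_nonneg_right a5 h]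
      · rcases le_total (α - b w) 0 with h | h
        · exact (mul_nonpos_of_nonneg_of_nonpos hcpos.le h).trans (abs_nonneg _)
        · refine le_trans ?_ (neg_le_abs _)
          rw [commFrac]
          nlinarith [mul_le_mul_of_nonneg_right a5 h]
    have h3 : ∫⁻ y in B, (ENNReal.ofReal (c * max (b y - β) (α - b y)) *
        ENNReal.ofReal (ω y)) ^ q ∂μ = 0 := by
      refine le_antisymm ?_ bot_le
      refine le_trans (setLIntegral_mono' hBm fun y hy => ?_) h2.le
      rw [← Real.mul_rpow (abs_nonneg _) (hω.1 y), ← ENNReal.ofReal_rpow_of_nonneg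
        (mul_nonneg (abs_nonneg _) (hω.1 y)) hq0.le, ENNReal.ofReal_mul (abs_nonneg _)]
      refine ENNReal.rpow_le_rpow (mul_le_mul_left ?_ _) hq0.le
      exact ENNReal.ofReal_le_ofReal (hpt y hy)
    have hmeas : Measurable (fun y => (ENNReal.ofReal (c * max (b y - β) (α - b y)) *
        ENNReal.ofReal (ω y)) ^ q) :=
      (((((hb.1.sub_const β).max (hb.1.const_sub α)).const_mul c).ennreal_ofReal).mul
        hω.2.1.ennreal_ofReal).pow_const q
    rw [lintegral_eq_zero_iff hmeas] at h3
    filter_upwards [h3] with y hy hy0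
    simp only [Pi.zero_apply] at hy
    rw [ENNReal.rpow_eq_zero_iff_of_pos hq0, mul_eq_zero, ENNReal.ofReal_eq_zero,
      ENNReal.ofReal_eq_zero] at hy
    rcases hy with hy | hy
    · have h4 : max (b y - β) (α - b y) ≤ 0 := by
        by_contra! hcon
        exact absurd hy (not_le.2 (mul_pos hcpos hcon))
      have := max_le_iff.1 h4
      exact ⟨by linarith, by linarith⟩
    · linarith
  have key2 : ∀ᵐ y ∂μ, ∀ m : ℕ, n ≤ m → y ∈ ball d x₀ (2 ^ m * 1) →
      0 < ω y → α ≤ b y ∧ b y ≤ β := by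
    rw [ae_all_iff]
    intro m
    by_cases hnm : n ≤ m
    · filter_upwards [(ae_restrict_iff' (hX.measurableSet_ball _ _)).1 (key m hnm)] with y hy
      exact fun _ => hy
    · exact Filter.Eventually.of_forall fun y h => absurd h hnm
  filter_upwards [key2] with y hy
  have hyU : y ∈ ⋃ k : ℕ, ball d x₀ (2 ^ k * 1) := by rw [hU]; trivial
  obtain ⟨k, hk⟩ := Set.mem_iUnion.1 hyU
  refine hy (max n k) (le_max_left _ _) (aux_ball_mono x₀ ?_ hk)
  gcongr
  · norm_num
  · exact le_max_right _ _

theorem aux_mix2 {X : Type*} [MeasurableSpace X] {μ : Measure X}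
    {ω b : X → ℝ} (hω : ∀ y, 0 ≤ ω y)
    (hE : ¬ ∀ᵐ y ∂μ, ω y = 0) (hZ : ¬ ∀ᵐ y ∂μ, 0 < ω y)
    (h : ∀ α β : ℝ, μ {y | ω y = 0 ∧ α ≤ |b y| ∧ |b y| ≤ β} ≠ 0 →
      ∀ᵐ y ∂μ, 0 < ω y → α ≤ b y ∧ b y ≤ β) :
    ∃ c : ℝ, (∀ᵐ y ∂μ, |b y| = c) ∧ ∀ᵐ y ∂μ, ω y = 0 ∨ b y = c := by
  have g1 : ∀ᵐ y ∂μ, ∀ α β : ℚ, μ {y | ω y = 0 ∧ (α : ℝ) ≤ |b y| ∧ |b y| ≤ β} ≠ 0 →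
      0 < ω y → α ≤ b y ∧ b y ≤ β := by
    rw [ae_all_iff]; intro α
    rw [ae_all_iff]; intro β
    by_cases hz : μ {y | ω y = 0 ∧ (α : ℝ) ≤ |b y| ∧ |b y| ≤ β} ≠ 0
    · filter_upwards [h α β hz] with y hy
      exact fun _ => hy
    · exact Filter.Eventually.of_forall fun y h => absurd h hz
  have g2 : ∀ᵐ y ∂μ, ∀ α β : ℚ, ω y = 0 → (α : ℝ) ≤ |b y| → |b y| ≤ β →
      μ {y | ω y = 0 ∧ (α : ℝ) ≤ |b y| ∧ |b y| ≤ β} ≠ 0 := by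
    rw [ae_all_iff]; intro α
    rw [ae_all_iff]; intro β
    by_cases hz : μ {y | ω y = 0 ∧ (α : ℝ) ≤ |b y| ∧ |b y| ≤ β} = 0
    · have := measure_eq_zero_iff_ae_notMem.1 hz
      filter_upwards [this] with y hy h1 h2 h3
      exact absurd ⟨h1, h2, h3⟩ hy
    · exact Filter.Eventually.of_forall fun y _ _ _ => hz
  -- comparison of good points
  have cmp : ∀ x y, (∀ α β : ℚ, μ {y | ω y = 0 ∧ (α : ℝ) ≤ |b y| ∧ |b y| ≤ β} ≠ 0 →
      0 < ω x → α ≤ b x ∧ b x ≤ β) →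
      (∀ α β : ℚ, ω y = 0 → (α : ℝ) ≤ |b y| → |b y| ≤ β →
      μ {y | ω y = 0 ∧ (α : ℝ) ≤ |b y| ∧ |b y| ≤ β} ≠ 0) → 0 < ω x → ω y = 0 →
      b x = |b y| := by
    intro x y hx hy hx0 hy0
    apply le_antisymm
    · by_contra! hcon
      obtain ⟨β, h1, h2⟩ := exists_rat_btwn hcon
      obtain ⟨α, h3⟩ := exists_rat_lt (|b y|)
      have := (hx α β (hy α β hy0 h3.le h1.le) hx0).2
      linarith
    · by_contra! hcon
      obtain ⟨α, h1, h2⟩ := exists_rat_btwn hcon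
      obtain ⟨β, h3⟩ := exists_rat_gt (|b y|)
      have := (hx α β (hy α β hy0 h2.le h3.le) hx0).1
      linarith
  have hx : ∃ x, (∀ α β : ℚ, μ {y | ω y = 0 ∧ (α : ℝ) ≤ |b y| ∧ |b y| ≤ β} ≠ 0 →
      0 < ω x → α ≤ b x ∧ b x ≤ β) ∧ 0 < ω x := by
    by_contra! hcon
    apply hE
    filter_upwards [g1] with y hy
    exact le_antisymm (hcon y hy) (hω y)
  have hy : ∃ y, (∀ α β : ℚ, ω y = 0 → (α : ℝ) ≤ |b y| → |b y| ≤ β →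
      μ {y | ω y = 0 ∧ (α : ℝ) ≤ |b y| ∧ |b y| ≤ β} ≠ 0) ∧ ω y = 0 := by
    by_contra! hcon
    apply hZ
    filter_upwards [g2] with y hy
    exact lt_of_le_of_ne (hω y) (Ne.symm (hcon y hy))
  obtain ⟨x, hx1, hx0⟩ := hx
  obtain ⟨y, hy1, hy0⟩ := hy
  have hxy := cmp x y hx1 hy1 hx0 hy0
  refine ⟨b x, ?_, ?_⟩
  · filter_upwards [g1, g2] with t ht1 ht2
    rcases (hω t).eq_or_lt with h0 | h0
    · exact (cmp x t hx1 ht2 hx0 h0.symm).symm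
    · rw [cmp t y ht1 hy1 h0 hy0, hxy, abs_abs]
  · filter_upwards [g1] with t ht1
    rcases (hω t).eq_or_lt with h0 | h0
    · exact Or.inl h0.symm
    · exact Or.inr (by rw [cmp t y ht1 hy1 h0 hy0, hxy])

theorem aux_mix3 {X : Type*} [MeasurableSpace X] {d : X → X → ℝ} {μ : Measure X}
    (hX : IsSHT d μ) {γ κ q : ℝ} (hγ : γ ∈ Set.Ioo (0 : ℝ) 1) (hq1 : 1 < q)
    {ω b : X → ℝ} (hb : LocInt d μ b) {c : ℝ}
    (h1 : ∀ᵐ y ∂μ, |b y| = c) (h2 : ∀ᵐ y ∂μ, ω y = 0 ∨ b y = c)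
    (x : X) (r : ℝ) (hr : 0 < r) :
    morrey d μ (fun t => ω t ^ q) q κ
          ((ball d x r).indicator
            (fun t => b t -
              (μ (ball d x r)).toReal ^ (-γ) *
                fracMaxLoc d μ γ (ball d x r) b t)) = 0 := by
  have havg : ∀ (z : X) (s : ℝ), 0 < s → avg μ (ball d z s) (fun y => |b y|) = c := by
    intro z s hs
    have hm := aux_real_pos hX z hs
    rw [avg, integral_congr_ae (g := fun _ => c) (ae_restrict_of_ae h1)]
    simp only [integral_const, measureReal_restrict_apply_univ, smul_eq_mul]
    simp only [Measure.real] at hm ⊢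
    field_simp
  have hbd := fun w => aux_bounds hX hγ hb (le_refl (0:ℝ))
    (fun x z w r s hr hs _ _ _ => by rw [havg x r hr, havg z s hs]; simp) x w hr
  have hm := aux_real_pos hX x hr
  refine aux_null d μ (by linarith) _ _ ?_
  filter_upwards [h2] with y hy
  rcases hy with hy | hy
  · exact Or.inl hy
  · right
    by_cases hyQ : y ∈ ball d x r
    · rw [Set.indicator_of_mem hyQ]
      obtain ⟨-, h3, h4⟩ := hbd y hyQ
      rw [havg x r hr] at h3 h4
      rw [add_zero] at h4
      rw [le_antisymm h4 h3, hy]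
      change c - μ.real _ ^ (-γ) * (μ.real _ ^ γ * c) = 0
      rw [← mul_assoc, ← Real.rpow_add hm]; simp
    · rw [Set.indicator_of_notMem hyQ]

/-- if `[M_γ, b]` is bounded from `L^{p,κ}_{(ω^p,ω^q)}(X)` to
`L^{q,κq/p}_{ω^q}(X)`, then `sup_Q ‖(b − μ(Q)^{-γ}M_{γ,Q}(b))χ_Q‖/‖χ_Q‖ ≤ C`. -/
theorem ball_estimate_of_commutator_fracMax_bounded
    {X : Type*} [MeasurableSpace X] (d : X → X → ℝ) (μ : MeasureTheory.Measure X)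
    (hX : IsSHT d μ) (hμtop : μ Set.univ = ⊤) (hatom : ∀ x : X, μ {x} = 0)
    (γ κ p q : ℝ) (hγ : γ ∈ Set.Ioo (0 : ℝ) 1) (hκ : κ ∈ Set.Ioo (0 : ℝ) 1)
    (hp : 1 < p) (hpγ : p < 1 / γ) (hq : 1 / q = 1 / p - γ)
    (ω : X → ℝ) (hω : IsWeight d μ ω) (hApq : MemApq d μ ω p q)
    (b : X → ℝ) (hb : LocInt d μ b)
    (hbdd : ∃ C₀ : ℝ≥0∞, C₀ ≠ ⊤ ∧ ∀ f : X → ℝ, Measurable f →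
      morrey2 d μ (fun t => ω t ^ p) (fun t => ω t ^ q) p κ f < ⊤ →
      morrey d μ (fun t => ω t ^ q) q (κ * q / p) (commFrac d μ γ b f) ≤
        C₀ * morrey2 d μ (fun t => ω t ^ p) (fun t => ω t ^ q) p κ f) :
    ∃ C : ℝ≥0∞, C ≠ ⊤ ∧ ∀ (x : X) (r : ℝ), 0 < r →
      morrey d μ (fun t => ω t ^ q) q (κ * q / p)
          ((ball d x r).indicator
            (fun t => b t -
              (μ (ball d x r)).toReal ^ (-γ) *
                fracMaxLoc d μ γ (ball d x r) b t)) ≤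
        C * morrey d μ (fun t => ω t ^ q) q (κ * q / p)
          ((ball d x r).indicator (fun _ => (1 : ℝ))) := by
  have hq1 : 1 < q := aux_q hγ hp hpγ hq
  obtain ⟨C₀, hC₀, hbdd⟩ := hbdd
  by_cases hE : ∀ᵐ y ∂μ, ω y = 0
  · refine ⟨1, by simp, fun x r hr => ?_⟩
    refine le_trans (le_of_eq ?_) bot_le
    refine aux_null d μ (by linarith) _ _ ?_
    filter_upwards [hE] with y hy
    exact Or.inl hy
  by_cases hpos : ∀ᵐ y ∂μ, 0 < ω y
  · rcases le_or_gt (κ * q / p) 1 with hκ1 | hκ1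
    · obtain ⟨D, hD0, hD⟩ :=
        aux_pos hX hμtop hγ hκ hp hq1 hq hκ1 hω hApq hpos hb hC₀ hbdd
      exact ⟨2 * C₀ + ENNReal.ofReal (4 * D),
        ENNReal.add_ne_top.2 ⟨ENNReal.mul_ne_top (by simp) hC₀, ENNReal.ofReal_ne_top⟩,
        aux_final hX hγ hκ hp hq1 hq hκ1 hω hApq hpos hb hbdd hD0 hD⟩
    · refine ⟨1, by simp, fun x r hr => ?_⟩
      rw [aux_top hX hatom hp hq1 hκ1 hω hApq hpos x hr]
      simp
  · obtain ⟨c, h1, h2⟩ := aux_mix2 hω.1 hE hpos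
      (fun α β => aux_mix1 hX hγ hκ hp hq1 hω hApq hb hbdd α β)
    refine ⟨1, by simp, fun x r hr => ?_⟩
    rw [aux_mix3 hX hγ hq1 hb h1 h2 x r hr]
    exact bot_le
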